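/- arXiv:2112.13405 — 2 statements merged into one kernel-verified Lean document; each statement's English description precedes it below -/
import Mathlib

section
/- The complex dimension of the first de Rham cohomology H^1_dR(𝔸¹, Sym^k Ai_n) = coker(D) equals (1/n)·binomial(k+n−1, k) − ((n+1)/n)·S_{n,k} (an equality of rational numbers; in particular the right-hand side is a non-negative integer). -/
open Polynomial

/-- The index set `P(n,k) = {a ∈ ℤ_{≥0}^n : a_0 + ⋯ + a_{n−1} = k}` of the basis
`u_a = v_0^{a_0}⋯v_{n−1}^{a_{n−1}}` of `Sym^k Ai_n` (each `a_i ≤ k` automatically). -/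
abbrev PIdx (n k : ℕ) := {a : Fin n → Fin (k + 1) // ∑ i, (a i : ℕ) = k}

/-- The underlying space of `Sym^k Ai_n`: the free `ℂ[z]`-module on the basis `(u_a)`,
an element being recorded by its coefficient function `P(n,k) → ℂ[z]`. -/
abbrev AiSym (n k : ℕ) := PIdx n k → Polynomial ℂ

/-- The action of `∂_z` on `Sym^k Ai_n`, determined by the Leibniz rule
`D(p·u_a) = p′·u_a + p·(Σ_{i=0}^{n−2} a_i·u_{a−δ_i+δ_{i+1}} + a_{n−1}·z·u_{a−δ_{n−1}+δ_0})`.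
The coefficient of `u_b` in `D f` is `(f b)′` plus, for each `a` and each `i` with
`a_i ≥ 1` and `a − δ_i + δ_{(i+1) mod n} = b`, the term `a_i·(z if i = n−1)·f a`. -/
noncomputable def AiD (n k : ℕ) : AiSym n k →ₗ[ℂ] AiSym n k :=
  LinearMap.pi fun b =>
    (Polynomial.derivative).comp (LinearMap.proj b) +
    ∑ a : PIdx n k, ∑ i : Fin n,
      if 1 ≤ (a.1 i : ℕ) ∧
          (fun l : Fin n => (a.1 l : ℕ) + (if (l : ℕ) = ((i : ℕ) + 1) % n then 1 else 0)
            - (if l = i then 1 else 0)) = (fun l : Fin n => (b.1 l : ℕ)) then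
        (LinearMap.mulLeft ℂ
          (((a.1 i : ℕ) : Polynomial ℂ) * (if (i : ℕ) = n - 1 then X else 1))).comp
          (LinearMap.proj a)
      else 0

/-- The linear-algebra data behind a connection `∂_z + N + z L` on a trivial bundle over the affine
line whose fibre is graded by `wt`, with `N` raising the weight by `1` and `L` lowering it
by `n - 1`. The last fields say that `N + L` is semisimple at the eigenvalue zero, and that the
kernel of `N + L` carries no resonance: the critical exponent there is `c / 2`, which is
smaller than the top weight of every kernel element. -/
structure GradedConnection (ι : Type) [Fintype ι] where
  n : ℕ
  n_pos : 0 < n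
  c : ℕ
  wt : ι → ℕ
  N : Matrix ι ι ℂ
  L : Matrix ι ι ℂ
  N_wt : ∀ a b, N b a ≠ 0 → wt b = wt a + 1
  L_wt : ∀ a b, L b a ≠ 0 → wt b + n = wt a + 1
  isCompl : IsCompl (LinearMap.ker (N + L).mulVecLin) (LinearMap.range (N + L).mulVecLin)
  weight_mem_range : ∀ P ∈ LinearMap.ker (N + L).mulVecLin,
    (fun b => ((wt b : ℂ) - (c : ℂ) / 2) * P b) ∈ LinearMap.range (N + L).mulVecLin
  exists_wt_lt : ∀ P ∈ LinearMap.ker (N + L).mulVecLin, P ≠ 0 → ∃ b, P b ≠ 0 ∧ c < 2 * wt b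

/-- The `m`-th coefficient of a polynomial, extended by zero to integral `m`. -/
noncomputable def zcoeff (m : ℤ) : ℂ[X] →ₗ[ℂ] ℂ :=
  if 0 ≤ m then lcoeff ℂ m.toNat else 0

lemma zcoeff_natCast (m : ℕ) (p : ℂ[X]) : zcoeff m p = p.coeff m := by
  simp [zcoeff]

lemma zcoeff_of_neg {m : ℤ} (hm : m < 0) (p : ℂ[X]) : zcoeff m p = 0 := by
  simp [zcoeff, not_le.2 hm]

lemma zcoeff_derivative (m : ℤ) (p : ℂ[X]) :
    zcoeff m (derivative p) = ((m : ℂ) + 1) * zcoeff (m + 1) p := by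
  rcases lt_trichotomy m (-1) with h | rfl | h
  · rw [zcoeff_of_neg (by lia), zcoeff_of_neg (by lia), mul_zero]
  · rw [zcoeff_of_neg (by lia)]; simp
  · obtain ⟨k, rfl⟩ := Int.eq_ofNat_of_zero_le (show 0 ≤ m by lia)
    rw [show ((k : ℤ) + 1) = ((k + 1 : ℕ) : ℤ) by push_cast; rfl, zcoeff_natCast, zcoeff_natCast,
      coeff_derivative]
    push_cast; ring

lemma zcoeff_X_mul (m : ℤ) (p : ℂ[X]) : zcoeff m (X * p) = zcoeff (m - 1) p := by
  rcases lt_trichotomy m 0 with h | rfl | h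
  · rw [zcoeff_of_neg h, zcoeff_of_neg (by lia)]
  · rw [zcoeff_of_neg (m := 0 - 1) (by norm_num)]
    exact (zcoeff_natCast 0 _).trans (by simp)
  · obtain ⟨k, rfl⟩ := Int.eq_ofNat_of_zero_le (show 0 ≤ m - 1 by lia)|>.imp
      fun k hk => (show m = ((k + 1 : ℕ) : ℤ) by push_cast; lia)
    rw [zcoeff_natCast, coeff_X_mul]
    simp [zcoeff_natCast]

lemma zcoeff_C_mul (m : ℤ) (r : ℂ) (p : ℂ[X]) : zcoeff m (C r * p) = r * zcoeff m p := by
  rw [← smul_eq_C_mul, map_smul, smul_eq_mul]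

lemma zcoeff_monomial (m : ℤ) (k : ℕ) (r : ℂ) :
    zcoeff m (monomial k r) = if m = k then r else 0 := by
  rcases lt_or_ge m 0 with h | h
  · rw [zcoeff_of_neg h, if_neg (by lia)]
  · obtain ⟨j, rfl⟩ := Int.eq_ofNat_of_zero_le h
    rw [zcoeff_natCast, coeff_monomial]
    simp [eq_comm]

lemma sum_range_mod_add {α : Type*} [AddCommMonoid α] (n : ℕ) (φ : ℕ → α) (a : ℕ) :
    ∑ j ∈ Finset.range n, φ ((a + j) % n) = ∑ j ∈ Finset.range n, φ j := by
  induction a with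
  | zero =>
    refine Finset.sum_congr rfl fun j hj => ?_
    rw [zero_add, Nat.mod_eq_of_lt (Finset.mem_range.1 hj)]
  | succ a ih =>
    rw [← ih]
    rcases n with _ | n
    · simp
    rw [Finset.sum_range_succ, Finset.sum_range_succ' (fun j => φ ((a + j) % (n + 1)))]
    congr 1
    · exact Finset.sum_congr rfl fun j _ => by congr 2; ring
    · rw [show a + 1 + n = a + (n + 1) by ring, Nat.add_mod_right, add_zero]

lemma finrank_inf_ker_add_finrank_map {V W : Type*} [AddCommGroup V] [Module ℂ V]
    [AddCommGroup W] [Module ℂ W] (f : V →ₗ[ℂ] W) (U : Submodule ℂ V) [FiniteDimensional ℂ U] :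
    Module.finrank ℂ (U ⊓ LinearMap.ker f : Submodule ℂ V) + Module.finrank ℂ (U.map f)
      = Module.finrank ℂ U := by
  have h := LinearMap.finrank_range_add_finrank_ker (f.domRestrict U)
  rw [← h, LinearMap.range_domRestrict, add_comm, LinearMap.ker_domRestrict,
    ← Submodule.map_comap_subtype, LinearEquiv.finrank_eq (Submodule.equivMapOfInjective _
      U.injective_subtype _)]

namespace GradedConnection

variable {ι : Type} [Fintype ι] (G : GradedConnection ι)

/-- The endomorphism `N + L` of the fibre. -/
noncomputable abbrev T : (ι → ℂ) →ₗ[ℂ] (ι → ℂ) := (G.N + G.L).mulVecLin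

lemma T_apply (P : ι → ℂ) (b : ι) :
    G.T P b = ∑ a, G.N b a * P a + ∑ a, G.L b a * P a := by
  simp [T, Matrix.mulVec, dotProduct]

/-- The connection `∂_z + N + z L`. -/
noncomputable def D : (ι → ℂ[X]) →ₗ[ℂ] (ι → ℂ[X]) :=
  LinearMap.pi fun b => derivative.comp (LinearMap.proj b) +
    ∑ a, (LinearMap.mulLeft ℂ (C (G.N b a) + C (G.L b a) * X)).comp (LinearMap.proj a)

lemma zcoeff_D (m : ℤ) (f : ι → ℂ[X]) (b : ι) :
    zcoeff m (G.D f b) = ((m : ℂ) + 1) * zcoeff (m + 1) (f b)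
      + (∑ a, G.N b a * zcoeff m (f a) + ∑ a, G.L b a * zcoeff (m - 1) (f a)) := by
  simp [D, add_mul, mul_assoc, Finset.sum_add_distrib, zcoeff_derivative, zcoeff_C_mul,
    zcoeff_X_mul]

/-- The component of weight `e` of a section, where `z` has weight `n`. -/
noncomputable def comp (e : ℤ) : (ι → ℂ[X]) →ₗ[ℂ] (ι → ℂ) :=
  LinearMap.pi fun b => if (G.n : ℤ) ∣ e - G.wt b then
    (zcoeff ((e - G.wt b) / G.n)).comp (LinearMap.proj b) else 0

lemma comp_of_eq {e : ℤ} {b : ι} {m : ℤ} (h : e = G.wt b + G.n * m) (f : ι → ℂ[X]) :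
    G.comp e f b = zcoeff m (f b) := by
  have hn : (G.n : ℤ) ≠ 0 := by exact_mod_cast G.n_pos.ne'
  subst h
  simp [comp, Int.mul_ediv_cancel_left _ hn]

lemma comp_of_not_dvd {e : ℤ} {b : ι} (h : ¬ (G.n : ℤ) ∣ e - G.wt b) (f : ι → ℂ[X]) :
    G.comp e f b = 0 := by
  simp [comp, h]

lemma comp_D (e : ℤ) (f : ι → ℂ[X]) :
    G.comp e (G.D f) = G.T (G.comp (e - 1) f)
      + fun b => ((e + G.n - G.wt b : ℂ) / G.n) * G.comp (e + G.n) f b := by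
  have hn : (G.n : ℂ) ≠ 0 := by exact_mod_cast G.n_pos.ne'
  ext b
  rw [Pi.add_apply, T_apply]
  by_cases h : (G.n : ℤ) ∣ e - G.wt b
  · obtain ⟨m, hm⟩ := h
    rw [G.comp_of_eq (m := m) (by lia), zcoeff_D,
      G.comp_of_eq (b := b) (m := m + 1) (e := e + G.n) (by rw [mul_add]; lia), add_comm]
    congr 1
    · congr 1 <;> refine Finset.sum_congr rfl fun a _ => ?_
      · by_cases h0 : G.N b a = 0
        · simp [h0]
        · have := G.N_wt a b h0
          rw [G.comp_of_eq (m := m) (by lia)]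
      · by_cases h0 : G.L b a = 0
        · simp [h0]
        · have := G.L_wt a b h0
          rw [G.comp_of_eq (m := m - 1) (by rw [mul_sub]; lia)]
    · have : (e : ℂ) = G.wt b + G.n * m := by
        have : e = G.wt b + G.n * m := by lia
        rw [this]; push_cast; ring
      rw [this]
      congr 1
      field_simp
      ring
  · have h2 : ¬ (G.n : ℤ) ∣ e + G.n - G.wt b := by
      rwa [show e + G.n - G.wt b = e - G.wt b + G.n by ring, dvd_add_self_right]
    rw [G.comp_of_not_dvd h, G.comp_of_not_dvd h2, mul_zero, add_zero,
      Finset.sum_eq_zero, Finset.sum_eq_zero, add_zero]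
    · intro a _
      by_cases h0 : G.L b a = 0
      · simp [h0]
      · have := G.L_wt a b h0
        rw [G.comp_of_not_dvd, mul_zero]
        rwa [show e - 1 - G.wt a = e - G.wt b - G.n by lia, dvd_sub_self_right]
    · intro a _
      by_cases h0 : G.N b a = 0
      · simp [h0]
      · have := G.N_wt a b h0
        rw [G.comp_of_not_dvd, mul_zero]
        rwa [show e - 1 - G.wt a = e - G.wt b by lia]

lemma comp_D_of_comp_eq_zero {e : ℤ} {f : ι → ℂ[X]} (h : G.comp (e + G.n) f = 0) :
    G.comp e (G.D f) = G.T (G.comp (e - 1) f) := by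
  rw [comp_D, h]
  ext b
  simp

lemma eq_zero_of_comp (f : ι → ℂ[X]) (h : ∀ e, G.comp e f = 0) : f = 0 := by
  ext b m
  rw [← zcoeff_natCast, ← G.comp_of_eq (e := G.wt b + G.n * m) rfl, h]
  simp

/-- The values of the components of weight `e`. -/
def fiber (e : ℤ) : Submodule ℂ (ι → ℂ) where
  carrier := {P | ∀ b, P b ≠ 0 → (G.n : ℤ) ∣ e - G.wt b ∧ (G.wt b : ℤ) ≤ e}
  add_mem' {P Q} hP hQ b hb := by
    by_cases h : P b = 0
    · exact hQ b (by simpa [h] using hb)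
    · exact hP b h
  zero_mem' b hb := absurd rfl hb
  smul_mem' r P hP b hb := hP b (right_ne_zero_of_mul hb)

/-- The part of the fibre supported in weights congruent to `e`. -/
def residue (e : ℤ) : Submodule ℂ (ι → ℂ) where
  carrier := {P | ∀ b, P b ≠ 0 → (G.n : ℤ) ∣ e - G.wt b}
  add_mem' {P Q} hP hQ b hb := by
    by_cases h : P b = 0
    · exact hQ b (by simpa [h] using hb)
    · exact hP b h
  zero_mem' b hb := absurd rfl hb
  smul_mem' r P hP b hb := hP b (right_ne_zero_of_mul hb)

lemma comp_mem_fiber (e : ℤ) (f : ι → ℂ[X]) : G.comp e f ∈ G.fiber e := by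
  intro b hb
  by_cases h : (G.n : ℤ) ∣ e - G.wt b
  · refine ⟨h, ?_⟩
    obtain ⟨m, hm⟩ := h
    rw [G.comp_of_eq (m := m) (by lia)] at hb
    have : 0 ≤ m := not_lt.1 fun h => hb (zcoeff_of_neg h _)
    have : 0 ≤ (G.n : ℤ) * m := by positivity
    lia
  · exact absurd (G.comp_of_not_dvd h f) hb

lemma fiber_eq_residue {e : ℤ} (he : ∀ b, (G.wt b : ℤ) ≤ e) : G.fiber e = G.residue e :=
  le_antisymm (fun _ hP b hb => (hP b hb).1) fun _ hP b hb => ⟨hP b hb, he b⟩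

lemma residue_emod (e : ℤ) : G.residue (e % G.n) = G.residue e := by
  ext P
  refine forall₂_congr fun b _ => ?_
  rw [Int.dvd_iff_emod_eq_zero, Int.dvd_iff_emod_eq_zero, Int.emod_sub_emod]

/-- The homogeneous section of weight `e` with prescribed component. -/
noncomputable def lift (e : ℤ) (P : ι → ℂ) : ι → ℂ[X] :=
  fun b => monomial ((e - G.wt b) / G.n).toNat (P b)

lemma comp_lift {e : ℤ} {P : ι → ℂ} (hP : P ∈ G.fiber e) (i : ℤ) :
    G.comp i (G.lift e P) = if i = e then P else 0 := by
  have hn : (0 : ℤ) < G.n := by exact_mod_cast G.n_pos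
  ext b
  by_cases hb : P b = 0
  · have : G.lift e P b = 0 := by simp [lift, hb]
    have h2 : G.comp i (G.lift e P) b = 0 := by
      by_cases h : (G.n : ℤ) ∣ i - G.wt b
      · obtain ⟨m, hm⟩ := h
        rw [G.comp_of_eq (m := m) (by lia), this, map_zero]
      · exact G.comp_of_not_dvd h _
    rw [h2]; split_ifs <;> simp [hb]
  · obtain ⟨⟨q, hq⟩, h2⟩ := hP b hb
    have hq0 : 0 ≤ q := by
      by_contra h
      have : (G.n : ℤ) * q < 0 := mul_neg_of_pos_of_neg hn (not_le.1 h)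
      lia
    by_cases h : (G.n : ℤ) ∣ i - G.wt b
    · obtain ⟨m, hm⟩ := h
      rw [G.comp_of_eq (m := m) (by lia), lift, hq, Int.mul_ediv_cancel_left _ hn.ne',
        zcoeff_monomial, Int.toNat_of_nonneg hq0]
      have : i = e ↔ m = q := by
        constructor
        · rintro rfl
          exact mul_left_cancel₀ hn.ne' (hm.symm.trans hq)
        · rintro rfl
          lia
      simp only [this]
      split_ifs <;> rfl
    · rw [G.comp_of_not_dvd h, if_neg]
      · rfl
      · rintro rfl
        exact h ⟨q, hq⟩

lemma exists_comp_eq_zero (f : ι → ℂ[X]) : ∃ E : ℤ, ∀ i > E, G.comp i f = 0 := by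
  refine ⟨∑ b, (G.wt b + G.n * (f b).natDegree : ℤ), fun i hi => ?_⟩
  ext b
  by_cases h : (G.n : ℤ) ∣ i - G.wt b
  · obtain ⟨m, hm⟩ := h
    have h1 : (G.wt b + G.n * (f b).natDegree : ℤ) ≤ ∑ b, (G.wt b + G.n * (f b).natDegree : ℤ) :=
      Finset.single_le_sum (f := fun b => (G.wt b + G.n * (f b).natDegree : ℤ))
        (fun _ _ => by positivity) (Finset.mem_univ b)
    have h2 : (G.n : ℤ) * (f b).natDegree < G.n * m := by lia
    have h3 := lt_of_mul_lt_mul_left h2 (by positivity)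
    obtain ⟨k, rfl⟩ := Int.eq_ofNat_of_zero_le (show 0 ≤ m by lia)
    rw [G.comp_of_eq (m := k) (by lia), zcoeff_natCast, coeff_eq_zero_of_natDegree_lt (by lia)]
    rfl
  · exact G.comp_of_not_dvd h _

lemma eq_zero_of_mem_range {e : ℤ} {P : ι → ℂ} (hP : P ∈ G.fiber e) (hT : G.T P = 0)
    (hr : (fun b => ((e - G.wt b : ℂ) / G.n) * P b) ∈ LinearMap.range G.T) : P = 0 := by
  by_contra h0
  have hn : (G.n : ℂ) ≠ 0 := by exact_mod_cast G.n_pos.ne'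
  obtain ⟨b, hb, hc⟩ := G.exists_wt_lt P hT h0
  have he : (G.c : ℤ) < 2 * e := by have := (hP b hb).2; lia
  have hs : (e : ℂ) - (G.c : ℂ) / 2 ≠ 0 := by
    intro h
    have : (2 * e : ℂ) = G.c := by linear_combination 2 * h
    have : 2 * e = G.c := by exact_mod_cast this
    lia
  have h2 : ((e : ℂ) - (G.c : ℂ) / 2) • P ∈ LinearMap.range G.T := by
    convert add_mem (Submodule.smul_mem _ (G.n : ℂ) hr) (G.weight_mem_range P hT) using 1
    ext b
    simp only [Pi.smul_apply, Pi.add_apply, smul_eq_mul]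
    field_simp
    ring
  rw [Submodule.smul_mem_iff _ hs] at h2
  exact h0 ((Submodule.disjoint_def.1 G.isCompl.disjoint) P hT h2)

/-- Sections of weight at most `e`. -/
def fil (e : ℤ) : Submodule ℂ (ι → ℂ[X]) where
  carrier := {f | ∀ i > e, G.comp i f = 0}
  add_mem' hf hg i hi := by rw [map_add, hf i hi, hg i hi, add_zero]
  zero_mem' i _ := map_zero _
  smul_mem' r f hf i hi := by rw [map_smul, hf i hi, smul_zero]

/-- Sections whose components of weight exceeding `d` lie in the kernel of `T`. -/
def almost (d : ℤ) : Submodule ℂ (ι → ℂ[X]) where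
  carrier := {f | ∀ i > d, G.T (G.comp i f) = 0}
  add_mem' hf hg i hi := by rw [map_add, map_add, hf i hi, hg i hi, add_zero]
  zero_mem' i _ := by rw [map_zero, map_zero]
  smul_mem' r f hf i hi := by rw [map_smul, map_smul, hf i hi, smul_zero]

lemma D_mem_fil_iff (d : ℤ) (f : ι → ℂ[X]) :
    G.D f ∈ G.fil (d + 1) ↔ f ∈ G.fil (d + 1 + G.n) ⊓ G.almost d := by
  constructor
  · intro h
    have key : ∀ i, i > d + 1 + G.n → (∀ j > i, G.comp j f = 0) → G.comp i f = 0 := by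
      intro i hi hj
      refine G.eq_zero_of_mem_range (G.comp_mem_fiber i f) ?_ ?_
      · have h1 := h (i + 1) (by lia)
        rwa [comp_D_of_comp_eq_zero G (hj (i + 1 + G.n) (by lia)), add_sub_cancel_right] at h1
      · have h1 := h (i - G.n) (by lia)
        rw [comp_D, sub_add_cancel] at h1
        refine ⟨-G.comp (i - G.n - 1) f, ?_⟩
        rw [map_neg, neg_eq_iff_add_eq_zero, ← h1]
        congr 1
        ext b
        push_cast
        ring
    obtain ⟨E, hE⟩ := G.exists_comp_eq_zero f
    have key2 : ∀ j : ℕ, ∀ i > E - j, i > d + 1 + G.n → G.comp i f = 0 := by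
      intro j
      induction j with
      | zero => exact fun i hi _ => hE i (by simpa using hi)
      | succ j ih =>
        intro i hi hi2
        exact key i hi2 fun l hl => ih l (by push_cast at hi; lia) (by lia)
    have h1 : f ∈ G.fil (d + 1 + G.n) := fun i hi => key2 (E - i + 1).toNat i (by lia) hi
    refine ⟨h1, fun i hi => ?_⟩
    have h2 := h (i + 1) (by lia)
    rwa [comp_D_of_comp_eq_zero G (h1 (i + 1 + G.n) (by lia)), add_sub_cancel_right] at h2
  · rintro ⟨h1, h2⟩ i hi
    rw [comp_D_of_comp_eq_zero G (h1 (i + G.n) (by lia)), h2 (i - 1) (by lia)]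

lemma D_injective : Function.Injective G.D := by
  rw [← LinearMap.ker_eq_bot, LinearMap.ker_eq_bot']
  intro f hf
  refine G.eq_zero_of_comp f fun e => ?_
  have h : G.D f ∈ G.fil (e - 2 - G.n + 1) := by rw [hf]; exact zero_mem _
  exact ((G.D_mem_fil_iff _ _).1 h).1 e (by lia)

/-- The projection of the fibre onto the part of weight congruent to `e`. -/
noncomputable def proj (e : ℤ) : (ι → ℂ) →ₗ[ℂ] (ι → ℂ) :=
  LinearMap.pi fun b => if (G.n : ℤ) ∣ e - G.wt b then LinearMap.proj b else 0

lemma proj_apply (e : ℤ) (P : ι → ℂ) (b : ι) :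
    G.proj e P b = if (G.n : ℤ) ∣ e - G.wt b then P b else 0 := by
  simp only [proj, LinearMap.pi_apply]
  split_ifs <;> rfl

lemma proj_mem (e : ℤ) (P : ι → ℂ) : G.proj e P ∈ G.residue e := by
  intro b hb
  rw [proj_apply] at hb
  by_contra h
  exact hb (if_neg h)

lemma proj_of_mem {e : ℤ} {P : ι → ℂ} (hP : P ∈ G.residue e) : G.proj e P = P := by
  ext b
  rw [proj_apply]
  split_ifs with h
  · rfl
  · by_contra h2
    exact h (hP b (Ne.symm h2))

lemma proj_T (e : ℤ) (P : ι → ℂ) : G.proj (e + 1) (G.T P) = G.T (G.proj e P) := by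
  ext b
  rw [proj_apply, T_apply, T_apply]
  simp only [proj_apply]
  have h1 : ∀ a, G.N b a ≠ 0 → ((G.n : ℤ) ∣ e - G.wt a ↔ (G.n : ℤ) ∣ e + 1 - G.wt b) := by
    intro a ha
    rw [G.N_wt a b ha]
    push_cast
    rw [add_sub_add_right_eq_sub]
  have h2 : ∀ a, G.L b a ≠ 0 → ((G.n : ℤ) ∣ e - G.wt a ↔ (G.n : ℤ) ∣ e + 1 - G.wt b) := by
    intro a ha
    have := G.L_wt a b ha
    rw [show e - (G.wt a : ℤ) = e + 1 - G.wt b - G.n by lia, dvd_sub_self_right]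
  split_ifs with h
  · congr 1 <;> refine Finset.sum_congr rfl fun a _ => ?_
    · by_cases h0 : G.N b a = 0
      · simp [h0]
      · rw [if_pos ((h1 a h0).2 h)]
    · by_cases h0 : G.L b a = 0
      · simp [h0]
      · rw [if_pos ((h2 a h0).2 h)]
  · rw [Finset.sum_eq_zero, Finset.sum_eq_zero, add_zero]
    · intro a _
      by_cases h0 : G.L b a = 0
      · simp [h0]
      · rw [if_neg fun h' => h ((h2 a h0).1 h'), mul_zero]
    · intro a _
      by_cases h0 : G.N b a = 0
      · simp [h0]
      · rw [if_neg fun h' => h ((h1 a h0).1 h'), mul_zero]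

lemma residue_natCast_mod (m : ℕ) : G.residue ((m % G.n : ℕ) : ℤ) = G.residue m := by
  rw [Int.natCast_mod, residue_emod]

lemma sum_finrank_inf_residue (K : Submodule ℂ (ι → ℂ)) (hK : ∀ e, ∀ P ∈ K, G.proj e P ∈ K)
    (a : ℕ) :
    ∑ j ∈ Finset.range G.n,
      Module.finrank ℂ (K ⊓ G.residue ((a + j : ℕ) : ℤ) : Submodule ℂ (ι → ℂ)) =
      Module.finrank ℂ K := by
  have h0 := sum_range_mod_add G.n
    (fun m => Module.finrank ℂ (K ⊓ G.residue (m : ℤ) : Submodule ℂ (ι → ℂ))) a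
  have hmod : ∀ m : ℕ, Module.finrank ℂ (K ⊓ G.residue ((m % G.n : ℕ) : ℤ) : Submodule ℂ (ι → ℂ))
      = Module.finrank ℂ (K ⊓ G.residue (m : ℤ) : Submodule ℂ (ι → ℂ)) := fun m => by
    rw [residue_natCast_mod]
  simp only [hmod] at h0
  rw [h0, ← Fin.sum_univ_eq_sum_range
    (fun m : ℕ => Module.finrank ℂ (K ⊓ G.residue (m : ℤ) : Submodule ℂ (ι → ℂ))),
    ← Module.finrank_pi_fintype]
  symm
  let Φ : K →ₗ[ℂ] (∀ j : Fin G.n, (K ⊓ G.residue ((j : ℕ) : ℤ) : Submodule ℂ (ι → ℂ))) :=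
    LinearMap.pi fun j => ((G.proj (j : ℕ)).comp K.subtype).codRestrict _
      fun P => ⟨hK _ _ P.2, G.proj_mem _ _⟩
  have hΦ : ∀ P j, ((Φ P j : ι → ℂ)) = G.proj (j : ℕ) P := fun P j => rfl
  refine LinearEquiv.finrank_eq (LinearEquiv.ofBijective Φ ⟨?_, ?_⟩)
  · rw [← LinearMap.ker_eq_bot, LinearMap.ker_eq_bot']
    intro P hP
    ext b
    have h1 := hΦ P ⟨G.wt b % G.n, Nat.mod_lt _ G.n_pos⟩
    rw [hP] at h1
    have h2 := congrFun h1 b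
    rw [proj_apply, if_pos] at h2
    · exact h2.symm
    · rw [← dvd_neg, neg_sub]
      push_cast
      exact Int.dvd_self_sub_emod
  · intro Q
    refine ⟨∑ j, ⟨Q j, (Q j).2.1⟩, ?_⟩
    ext j : 2
    rw [hΦ, AddSubmonoidClass.coe_finsetSum, map_sum, Finset.sum_eq_single j]
    · rw [G.proj_of_mem (Q j).2.2]
    · intro l _ hl
      ext b
      rw [proj_apply]
      split_ifs with h
      · by_contra h2
        have h3 := dvd_sub h ((Q l).2.2 b h2)
        rw [sub_sub_sub_cancel_right] at h3
        refine hl (Fin.ext ?_)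
        have hj : ((j : ℕ) : ℤ) < G.n := by exact_mod_cast j.isLt
        have hl : ((l : ℕ) : ℤ) < G.n := by exact_mod_cast l.isLt
        have h4 := Int.eq_zero_of_abs_lt_dvd h3 (abs_lt.2 ⟨by omega, by omega⟩)
        omega
      · rfl
    · simp

lemma fil_succ_le {e : ℤ} (he : ∀ b, (G.wt b : ℤ) ≤ e) (hc : (G.c : ℤ) ≤ 2 * e) :
    G.fil (e + 1) ≤ G.fil e ⊔ LinearMap.range G.D := by
  intro g hg
  have hn : (G.n : ℂ) ≠ 0 := by exact_mod_cast G.n_pos.ne'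
  set s : ℂ := e + 1 + G.n - (G.c : ℂ) / 2 with hs_def
  have hs : s ≠ 0 := by
    intro h
    have : (2 * (e + 1 + G.n) : ℂ) = G.c := by linear_combination 2 * h
    have : 2 * (e + 1 + G.n) = G.c := by exact_mod_cast this
    lia
  obtain ⟨κ, hκ, _, ⟨h, rfl⟩, hsum⟩ := Submodule.mem_sup.1
    (G.isCompl.sup_eq_top ▸ Submodule.mem_top (x := G.comp (e + 1) g))
  obtain ⟨q, hq⟩ := G.weight_mem_range κ hκ
  have hP : G.comp (e + 1) g ∈ G.residue (e + 1) := by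
    rw [← G.fiber_eq_residue fun b => (he b).trans (by lia)]
    exact G.comp_mem_fiber _ _
  have hκ' : G.proj (e + 1) κ ∈ G.fiber (e + 1 + G.n) := by
    rw [G.fiber_eq_residue fun b => (he b).trans (by lia), ← residue_emod, Int.add_emod_right,
      residue_emod]
    exact G.proj_mem _ _
  have hh' : G.proj e (h + (s⁻¹ : ℂ) • q) ∈ G.fiber e := by
    rw [G.fiber_eq_residue he]
    exact G.proj_mem _ _
  have hTκ : G.T (G.proj (e + 1) κ) = 0 := by
    rw [← proj_T, show G.T κ = 0 from hκ, map_zero]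
  set f := G.lift e (G.proj e (h + (s⁻¹ : ℂ) • q))
    + G.lift (e + 1 + G.n) (((G.n : ℂ) * s⁻¹) • G.proj (e + 1) κ) with hf
  have hcomp : ∀ i, G.comp i f = (if i = e then G.proj e (h + (s⁻¹ : ℂ) • q) else 0) +
      (if i = e + 1 + G.n then ((G.n : ℂ) * s⁻¹) • G.proj (e + 1) κ else 0) := by
    intro i
    rw [hf, map_add, G.comp_lift hh', G.comp_lift (Submodule.smul_mem _ _ hκ')]
  have hn0 := G.n_pos
  refine Submodule.mem_sup.2 ⟨g - G.D f, fun i hi => ?_, G.D f, ⟨f, rfl⟩, sub_add_cancel _ _⟩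
  rw [map_sub, sub_eq_zero]
  by_cases hi1 : i = e + 1
  · subst hi1
    rw [comp_D, hcomp, hcomp, add_sub_cancel_right, if_pos rfl, if_neg (by lia), add_zero,
      if_neg (by lia), if_pos rfl, zero_add, ← proj_T, ← G.proj_of_mem hP, ← hsum, map_add, map_add,
      map_smul, hq]
    ext b
    simp only [Pi.add_apply, Pi.smul_apply, proj_apply, smul_eq_mul]
    split_ifs
    · push_cast
      change κ b + G.T h b = _
      field_simp
      rw [hs_def]
      ring
    · simp
  · rw [comp_D_of_comp_eq_zero, hcomp, if_neg (by lia), zero_add]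
    · rw [hg i (by lia)]
      split_ifs
      · rw [map_smul, hTκ, smul_zero]
      · rw [map_zero]
    · rw [hcomp, if_neg (by lia), if_neg (by lia), add_zero]

lemma fil_sup_range_D {d : ℤ} (he : ∀ b, (G.wt b : ℤ) ≤ d) (hc : (G.c : ℤ) ≤ 2 * d) :
    G.fil d ⊔ LinearMap.range G.D = ⊤ := by
  have h : ∀ j : ℕ, G.fil (d + j) ≤ G.fil d ⊔ LinearMap.range G.D := by
    intro j
    induction j with
    | zero => simp
    | succ j ih =>
      have h1 := G.fil_succ_le (e := d + j) (fun b => (he b).trans (by lia)) (by lia)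
      push_cast
      rw [← add_assoc]
      exact h1.trans (sup_le ih le_sup_right)
  rw [eq_top_iff]
  intro f _
  obtain ⟨E, hE⟩ := G.exists_comp_eq_zero f
  exact h (E - d).toNat fun i hi => hE i (by lia)

lemma comp_eq_zero_of_neg {i : ℤ} (hi : i < 0) (f : ι → ℂ[X]) : G.comp i f = 0 := by
  ext b
  by_contra h
  have := (G.comp_mem_fiber i f b h).2
  lia

instance (e : ℤ) : FiniteDimensional ℂ (G.fil e) := by
  let Φ : G.fil e →ₗ[ℂ] (Finset.Icc 0 e → ι → ℂ) :=
    LinearMap.pi fun i => (G.comp i).comp (G.fil e).subtype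
  refine FiniteDimensional.of_injective Φ ?_
  rw [← LinearMap.ker_eq_bot, LinearMap.ker_eq_bot']
  intro f hf
  refine Subtype.ext (G.eq_zero_of_comp _ fun i => ?_)
  rcases lt_or_ge i 0 with h | h
  · exact G.comp_eq_zero_of_neg h _
  · rcases lt_or_ge e i with h2 | h2
    · exact f.2 i h2
    · exact congrFun hf ⟨i, Finset.mem_Icc.2 ⟨h, h2⟩⟩

lemma finrank_fil_succ {d : ℤ} (he : ∀ b, (G.wt b : ℤ) ≤ d + 1) :
    Module.finrank ℂ (G.fil (d + 1)) = Module.finrank ℂ (G.fil d)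
      + Module.finrank ℂ (G.residue (d + 1)) := by
  have h1 : G.fil (d + 1) ⊓ LinearMap.ker (G.comp (d + 1)) = G.fil d := by
    refine le_antisymm ?_ fun f hf => ⟨fun i hi => hf i (by lia), hf _ (by lia)⟩
    rintro f ⟨h1, h2⟩ i hi
    rcases eq_or_ne i (d + 1) with rfl | h
    · exact h2
    · exact h1 i (by lia)
  have h2 : (G.fil (d + 1)).map (G.comp (d + 1)) = G.residue (d + 1) := by
    rw [← G.fiber_eq_residue he]
    refine le_antisymm ?_ fun P hP => ⟨G.lift (d + 1) P, fun i hi => ?_, ?_⟩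
    · rintro _ ⟨f, _, rfl⟩
      exact G.comp_mem_fiber _ _
    · rw [G.comp_lift hP, if_neg hi.ne']
    · rw [G.comp_lift hP, if_pos rfl]
  rw [← finrank_inf_ker_add_finrank_map (G.comp (d + 1)) (G.fil (d + 1)), h1, h2]

lemma finrank_fil_inf_almost {d : ℤ} (he : ∀ b, (G.wt b : ℤ) ≤ d + 1) (m : ℕ) :
    Module.finrank ℂ (G.fil (d + m) ⊓ G.almost d : Submodule ℂ (ι → ℂ[X])) =
      Module.finrank ℂ (G.fil d) + ∑ j ∈ Finset.range m, Module.finrank ℂ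
        (LinearMap.ker G.T ⊓ G.residue (d + 1 + j) : Submodule ℂ (ι → ℂ)) := by
  induction m with
  | zero =>
    have : G.fil d ⊓ G.almost d = G.fil d :=
      inf_eq_left.2 fun f hf i hi => by rw [hf i hi, map_zero]
    rw [Nat.cast_zero, add_zero, this, Finset.sum_range_zero, add_zero]
  | succ m ih =>
    have hdm : d + (m + 1 : ℕ) = d + 1 + m := by push_cast; ring
    have h1 : G.fil (d + 1 + m) ⊓ G.almost d ⊓ LinearMap.ker (G.comp (d + 1 + m))
        = G.fil (d + m) ⊓ G.almost d := by
      refine le_antisymm ?_ fun f hf => ⟨⟨fun i hi => hf.1 i (by lia), hf.2⟩, hf.1 _ (by lia)⟩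
      rintro f ⟨⟨h1, h3⟩, h2⟩
      refine ⟨fun i hi => ?_, h3⟩
      rcases eq_or_ne i (d + 1 + m) with rfl | h
      · exact h2
      · exact h1 i (by lia)
    have h2 : (G.fil (d + 1 + m) ⊓ G.almost d).map (G.comp (d + 1 + m))
        = LinearMap.ker G.T ⊓ G.residue (d + 1 + m) := by
      rw [← G.fiber_eq_residue fun b => (he b).trans (by lia)]
      refine le_antisymm ?_ ?_
      · rintro _ ⟨f, hf, rfl⟩
        exact ⟨hf.2 _ (by lia), G.comp_mem_fiber _ _⟩
      · rintro P ⟨hT, hP⟩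
        refine ⟨G.lift (d + 1 + m) P, ⟨fun i hi => ?_, fun i hi => ?_⟩, ?_⟩
        · rw [G.comp_lift hP, if_neg hi.ne']
        · rw [G.comp_lift hP]
          split_ifs
          · exact hT
          · exact map_zero _
        · rw [G.comp_lift hP, if_pos rfl]
    rw [Finset.sum_range_succ, ← add_assoc, ← ih, hdm,
      ← finrank_inf_ker_add_finrank_map (G.comp (d + 1 + m)), h1, h2]

lemma range_mkQ_comp_subtype {d : ℤ} (he : ∀ b, (G.wt b : ℤ) ≤ d) (hc : (G.c : ℤ) ≤ 2 * d) :
    LinearMap.range ((LinearMap.range G.D).mkQ.comp (G.fil d).subtype) = ⊤ := by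
  have h := congrArg (Submodule.map (LinearMap.range G.D).mkQ) (G.fil_sup_range_D he hc)
  rwa [Submodule.map_sup, Submodule.mkQ_map_self, sup_bot_eq, Submodule.map_top,
    Submodule.range_mkQ, ← (G.fil d).range_subtype, ← LinearMap.range_comp] at h

lemma finrank_coker_add {d : ℤ} (he : ∀ b, (G.wt b : ℤ) ≤ d + 1) (hc : (G.c : ℤ) ≤ 2 * (d + 1)) :
    Module.finrank ℂ ((ι → ℂ[X]) ⧸ LinearMap.range G.D)
      + ∑ j ∈ Finset.range (G.n + 1), Module.finrank ℂ
        (LinearMap.ker G.T ⊓ G.residue (d + 1 + j) : Submodule ℂ (ι → ℂ))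
      = Module.finrank ℂ (G.residue (d + 1)) := by
  have h1 := G.finrank_fil_succ he
  have h2 := G.finrank_fil_inf_almost he (G.n + 1)
  have h3 := LinearMap.finrank_range_add_finrank_ker
    ((LinearMap.range G.D).mkQ.comp (G.fil (d + 1)).subtype)
  rw [G.range_mkQ_comp_subtype he hc, finrank_top, LinearMap.ker_comp, Submodule.ker_mkQ,
    LinearEquiv.finrank_eq (Submodule.equivMapOfInjective _ (G.fil (d + 1)).injective_subtype _),
    Submodule.map_comap_subtype] at h3
  have h4 : G.fil (d + 1) ⊓ LinearMap.range G.D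
      = (G.fil (d + (G.n + 1 : ℕ)) ⊓ G.almost d).map G.D := by
    have hdn : d + (G.n + 1 : ℕ) = d + 1 + G.n := by push_cast; ring
    rw [hdn]
    refine le_antisymm ?_ ?_
    · rintro _ ⟨hf, f, rfl⟩
      exact ⟨f, (G.D_mem_fil_iff d f).1 hf, rfl⟩
    · rintro _ ⟨f, hf, rfl⟩
      exact ⟨(G.D_mem_fil_iff d f).2 hf, f, rfl⟩
  rw [h4, ← LinearEquiv.finrank_eq (Submodule.equivMapOfInjective _ G.D_injective _)] at h3
  lia

theorem finiteDimensional_coker : FiniteDimensional ℂ ((ι → ℂ[X]) ⧸ LinearMap.range G.D) := by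
  have h := G.range_mkQ_comp_subtype (d := (∑ b, G.wt b : ℕ) + G.c)
    (fun b => by
      have := Finset.single_le_sum (f := G.wt) (fun _ _ => Nat.zero_le _) (Finset.mem_univ b)
      lia) (by lia)
  exact Module.Finite.of_surjective _ (LinearMap.range_eq_top.1 h)

theorem finrank_coker :
    G.n * Module.finrank ℂ ((ι → ℂ[X]) ⧸ LinearMap.range G.D)
      + (G.n + 1) * Module.finrank ℂ (LinearMap.ker G.T) = Fintype.card ι := by
  set d := (∑ b, G.wt b) + G.c with hd
  have hw : ∀ b, G.wt b ≤ ∑ b, G.wt b := fun b =>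
    Finset.single_le_sum (f := G.wt) (fun _ _ => Nat.zero_le _) (Finset.mem_univ b)
  have h1 := fun i : ℕ => G.finrank_coker_add (d := d + i) (fun b => by have := hw b; lia) (by lia)
  have h2 := Finset.sum_congr (rfl : Finset.range G.n = _) fun i _ => h1 i
  rw [Finset.sum_add_distrib, Finset.sum_comm, Finset.sum_const, Finset.card_range,
    smul_eq_mul] at h2
  have h3 := G.sum_finrank_inf_residue ⊤ (fun _ _ _ => Submodule.mem_top) (d + 1)
  have h4 : ∀ j : ℕ, ∑ i ∈ Finset.range G.n, Module.finrank ℂ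
      (LinearMap.ker G.T ⊓ G.residue (d + i + 1 + j) : Submodule ℂ (ι → ℂ))
      = Module.finrank ℂ (LinearMap.ker G.T) := by
    intro j
    rw [← G.sum_finrank_inf_residue (LinearMap.ker G.T) (fun e P hP => ?_) (d + 1 + j)]
    · refine Finset.sum_congr rfl fun i _ => ?_
      rw [show ((d + 1 + j + i : ℕ) : ℤ) = d + i + 1 + j by push_cast; ring]
    · have := G.proj_T e P
      rw [show G.T P = 0 from hP, map_zero] at this
      exact this.symm
  simp only [h4, Finset.sum_const, Finset.card_range, smul_eq_mul] at h2
  rw [h2, ← Module.finrank_fintype_fun_eq_card ℂ, ← finrank_top ℂ (ι → ℂ), ← h3]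
  refine Finset.sum_congr rfl fun i _ => ?_
  rw [top_inf_eq, show ((d + 1 + i : ℕ) : ℤ) = d + i + 1 by push_cast; ring]

end GradedConnection

namespace MvPolynomial

/-- The derivation `X i ↦ c i * X (τ i)` of `ℂ[X_0, …, X_{n-1}]`. -/
noncomputable def substDerivation {n : ℕ} (c : Fin n → ℂ) (τ : Fin n → Fin n) :
    Derivation ℂ (MvPolynomial (Fin n) ℂ) (MvPolynomial (Fin n) ℂ) :=
  mkDerivation ℂ fun i => c i • X (τ i)

/-- The diagonal derivation `X i ↦ c i * X i`. -/
noncomputable abbrev diagDerivation {n : ℕ} (c : Fin n → ℂ) :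
    Derivation ℂ (MvPolynomial (Fin n) ℂ) (MvPolynomial (Fin n) ℂ) :=
  substDerivation c id

/-- The linear substitution `X i ↦ ∑ j, M i j * X j`. -/
noncomputable def linSubst {n : ℕ} (M : Matrix (Fin n) (Fin n) ℂ) :
    MvPolynomial (Fin n) ℂ →ₐ[ℂ] MvPolynomial (Fin n) ℂ :=
  aeval fun i => ∑ j, M i j • X j

variable {n : ℕ}

lemma substDerivation_X (c : Fin n → ℂ) (τ : Fin n → Fin n) (i : Fin n) :
    substDerivation c τ (X i) = c i • X (τ i) := by
  rw [substDerivation, mkDerivation_X]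

lemma coeff_substDerivation_monomial (c : Fin n → ℂ) (τ : Fin n → Fin n) (s t : Fin n →₀ ℕ)
    (r : ℂ) :
    coeff t (substDerivation c τ (monomial s r)) =
      ∑ i, if 1 ≤ s i ∧ s + Finsupp.single (τ i) 1 = t + Finsupp.single i 1
        then r * (s i * c i) else 0 := by
  rw [substDerivation, mkDerivation_monomial, Finsupp.sum_fintype _ _ (by simp), coeff_smul,
    coeff_sum, Finset.smul_sum]
  refine Finset.sum_congr rfl fun i _ => ?_
  rw [X, smul_monomial, smul_eq_mul, smul_eq_mul, monomial_mul, coeff_monomial, smul_eq_mul,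
    mul_one]
  rcases Nat.eq_zero_or_pos (s i) with h | h
  · simp [h]
  · have hiff : s - Finsupp.single i 1 + Finsupp.single (τ i) 1 = t ↔
        s + Finsupp.single (τ i) 1 = t + Finsupp.single i 1 := by
      rw [← add_left_inj (Finsupp.single i 1), add_right_comm,
        tsub_add_cancel_of_le (Finsupp.single_le_iff.2 h)]
    simp only [hiff, mul_ite, mul_zero, Nat.one_le_iff_ne_zero, h.ne', ne_eq, not_false_eq_true,
      true_and]

lemma coeff_diagDerivation (c : Fin n → ℂ) (t : Fin n →₀ ℕ) (p : MvPolynomial (Fin n) ℂ) :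
    coeff t (diagDerivation c p) = (∑ i, (t i : ℂ) * c i) * coeff t p := by
  classical
  induction p using MvPolynomial.induction_on' with
  | monomial s r =>
    rw [coeff_substDerivation_monomial, coeff_monomial]
    by_cases h : s = t
    · subst h
      rw [if_pos rfl, Finset.sum_mul]
      refine Finset.sum_congr rfl fun i _ => ?_
      split_ifs with h
      · ring
      · have : s i = 0 := by simpa using h
        simp [this]
    · rw [if_neg h, mul_zero]
      refine Finset.sum_eq_zero fun i _ => if_neg fun h1 => h ?_
      simpa using h1.2
  | add p q hp hq => rw [map_add, coeff_add, coeff_add, hp, hq, mul_add]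

lemma diagDerivation_eq_smul_iff (c : Fin n → ℂ) (p : MvPolynomial (Fin n) ℂ) (r : ℂ) :
    diagDerivation c p = r • p ↔ ∀ t, coeff t p ≠ 0 → ∑ i, (t i : ℂ) * c i = r := by
  rw [MvPolynomial.ext_iff]
  refine forall_congr' fun t => ?_
  rw [coeff_diagDerivation, coeff_smul, smul_eq_mul, mul_eq_mul_right_iff]
  tauto

lemma commutator_substDerivation {c d e : Fin n → ℂ} {τ ρ υ : Fin n → Fin n}
    (h : ∀ i, (d i * c (ρ i)) • X (τ (ρ i)) - (c i * d (τ i)) • X (ρ (τ i))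
      = e i • (X (υ i) : MvPolynomial (Fin n) ℂ))
    (p : MvPolynomial (Fin n) ℂ) :
    substDerivation c τ (substDerivation d ρ p) =
      substDerivation d ρ (substDerivation c τ p) + substDerivation e υ p := by
  have : ⁅substDerivation c τ, substDerivation d ρ⁆ = substDerivation e υ := by
    refine MvPolynomial.derivation_ext fun i => ?_
    rw [Derivation.commutator_apply, substDerivation_X, substDerivation_X, substDerivation_X,
      Derivation.map_smul, Derivation.map_smul, substDerivation_X, substDerivation_X,
    smul_smul, smul_smul, h]
  rw [← this, Derivation.commutator_apply]
  abel

lemma diagDerivation_substDerivation {c l : Fin n → ℂ} {τ : Fin n → Fin n} {s r : ℂ}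
    (h : ∀ i, c i ≠ 0 → l (τ i) = l i + s) {p : MvPolynomial (Fin n) ℂ}
    (hp : diagDerivation l p = r • p) :
    diagDerivation l (substDerivation c τ p) = (r + s) • substDerivation c τ p := by
  have hs : substDerivation (s • c) τ = s • substDerivation c τ := by
    refine derivation_ext fun i => ?_
    rw [substDerivation_X, Derivation.smul_apply, substDerivation_X, Pi.smul_apply, smul_assoc]
  have hcomm := commutator_substDerivation (c := l) (τ := id) (d := c) (ρ := τ) (e := s • c)
    (υ := τ) (fun i => ?_) p
  · rw [hcomm, hp, hs, Derivation.map_smul, Derivation.smul_apply, add_smul]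
  · simp only [id, ← sub_smul]
    by_cases hc : c i = 0
    · simp [hc]
    · rw [h i hc, Pi.smul_apply, smul_eq_mul]
      congr 1
      ring

lemma coeff_substDerivation_eq_zero {c l : Fin n → ℂ} {τ : Fin n → Fin n} {s : ℂ}
    (h : ∀ i, c i ≠ 0 → l (τ i) = l i + s) {p : MvPolynomial (Fin n) ℂ} {t : Fin n →₀ ℕ}
    (hp : ∀ u, coeff u p ≠ 0 → ∑ i, (u i : ℂ) * l i + s ≠ ∑ i, (t i : ℂ) * l i) :
    coeff t (substDerivation c τ p) = 0 := by
  rw [p.as_sum, map_sum, coeff_sum]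
  refine Finset.sum_eq_zero fun u hu => ?_
  by_contra hne
  refine hp u (mem_support_iff.1 hu) (((diagDerivation_eq_smul_iff _ _ _).1
    (diagDerivation_substDerivation h ?_) t hne).symm)
  rw [diagDerivation_eq_smul_iff]
  intro v hv
  rw [coeff_monomial] at hv
  rw [(ite_ne_right_iff.1 hv).1]

lemma derivation_linSubst {δ δ' : Derivation ℂ (MvPolynomial (Fin n) ℂ) (MvPolynomial (Fin n) ℂ)}
    {M : Matrix (Fin n) (Fin n) ℂ} (h : ∀ i, δ (linSubst M (X i)) = linSubst M (δ' (X i)))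
    (p : MvPolynomial (Fin n) ℂ) : δ (linSubst M p) = linSubst M (δ' p) := by
  induction p using MvPolynomial.induction_on with
  | C a => simp
  | add p q hp hq => simp only [map_add, hp, hq]
  | mul_X p i hp => simp only [map_mul, Derivation.leibniz, map_add, smul_eq_mul, hp, h]

lemma linSubst_X (M : Matrix (Fin n) (Fin n) ℂ) (i : Fin n) :
    linSubst M (X i) = ∑ j, M i j • X j := by
  rw [linSubst, aeval_X]

lemma linSubst_linSubst (M M' : Matrix (Fin n) (Fin n) ℂ) (p : MvPolynomial (Fin n) ℂ) :
    linSubst M (linSubst M' p) = linSubst (M' * M) p := by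
  rw [← AlgHom.comp_apply]
  congr 1
  ext1 i
  simp only [AlgHom.comp_apply, linSubst_X, map_sum, map_smul, Matrix.mul_apply, Finset.smul_sum,
    Finset.sum_smul, smul_smul]
  rw [Finset.sum_comm]

lemma linSubst_one (p : MvPolynomial (Fin n) ℂ) : linSubst 1 p = p := by
  rw [← AlgHom.id_apply (R := ℂ) p, ← AlgHom.comp_apply]
  congr 1
  ext1 i
  simp [linSubst_X, Matrix.one_apply]

lemma linSubst_bijective {M : Matrix (Fin n) (Fin n) ℂ} (hM : IsUnit M.det) :
    Function.Bijective (linSubst M) :=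
  Function.bijective_iff_has_inverse.2 ⟨linSubst M⁻¹,
    fun p => by rw [linSubst_linSubst, Matrix.mul_nonsing_inv _ hM, linSubst_one],
    fun p => by rw [linSubst_linSubst, Matrix.nonsing_inv_mul _ hM, linSubst_one]⟩

lemma diagDerivation_one_linSubst (M : Matrix (Fin n) (Fin n) ℂ) (p : MvPolynomial (Fin n) ℂ) :
    diagDerivation (fun _ => 1) (linSubst M p) = linSubst M (diagDerivation (fun _ => 1) p) := by
  refine derivation_linSubst (fun i => ?_) p
  simp [substDerivation_X, linSubst_X]

section Cyclic

variable [NeZero n]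

/-- The cyclic derivation `X i ↦ X (i + 1)`. -/
noncomputable abbrev cyclicDerivation (n : ℕ) [NeZero n] :
    Derivation ℂ (MvPolynomial (Fin n) ℂ) (MvPolynomial (Fin n) ℂ) :=
  substDerivation (fun _ => 1) fun i => i + 1

/-- The inverse cyclic derivation `X i ↦ X (i - 1)`. -/
noncomputable abbrev cyclicDerivationInv (n : ℕ) [NeZero n] :
    Derivation ℂ (MvPolynomial (Fin n) ℂ) (MvPolynomial (Fin n) ℂ) :=
  substDerivation (fun _ => 1) fun i => i - 1

lemma pow_val_add_one {x : ℂ} (hx : x ^ n = 1) (i : Fin n) :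
    x ^ ((i + 1 : Fin n) : ℕ) = x ^ (i : ℕ) * x := by
  rw [Fin.val_add, ← pow_eq_pow_mod _ hx, pow_add]
  congr 1
  rw [Fin.val_one', ← pow_eq_pow_mod _ hx, pow_one]

lemma cyclicDerivation_linSubst {x : Fin n → ℂ} (hx : ∀ i, x i ^ n = 1)
    (p : MvPolynomial (Fin n) ℂ) :
    cyclicDerivation n (linSubst (Matrix.vandermonde x) p) =
      linSubst (Matrix.vandermonde x) (diagDerivation (fun i => (x i)⁻¹) p) := by
  refine derivation_linSubst (fun i => ?_) p
  have hi : x i ≠ 0 := by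
    intro h
    simpa [h, NeZero.ne n] using hx i
  rw [substDerivation_X, map_smul, linSubst_X, map_sum, id, linSubst_X, Finset.smul_sum]
  refine Fintype.sum_equiv (Equiv.addRight (1 : Fin n)) _ _ fun j => ?_
  rw [Derivation.map_smul, substDerivation_X, one_smul, smul_smul, Equiv.coe_addRight,
    Matrix.vandermonde_apply, Matrix.vandermonde_apply, pow_val_add_one (hx i)]
  congr 1
  field_simp

lemma cyclicDerivationInv_linSubst {x : Fin n → ℂ} (hx : ∀ i, x i ^ n = 1)
    (p : MvPolynomial (Fin n) ℂ) :
    cyclicDerivationInv n (linSubst (Matrix.vandermonde x) p) =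
      linSubst (Matrix.vandermonde x) (diagDerivation x p) := by
  refine derivation_linSubst (fun i => ?_) p
  rw [substDerivation_X, map_smul, linSubst_X, map_sum, id, linSubst_X, Finset.smul_sum]
  refine (Fintype.sum_equiv (Equiv.addRight (1 : Fin n)) _ _ fun j => ?_).symm
  rw [Derivation.map_smul, substDerivation_X, one_smul, smul_smul, Equiv.coe_addRight,
    Matrix.vandermonde_apply, Matrix.vandermonde_apply, pow_val_add_one (hx i), mul_comm,
    add_sub_cancel_right]

/-- The inverses of the `n`-th roots of unity, `i ↦ ζ_n ^ (-(i + 1))`. -/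
noncomputable def rootInv (n : ℕ) (i : Fin n) : ℂ :=
  (Complex.exp (2 * (Real.pi : ℂ) * Complex.I / (n : ℂ)) ^ ((i : ℕ) + 1))⁻¹

lemma rootInv_pow (i : Fin n) : rootInv n i ^ n = 1 := by
  rw [rootInv, inv_pow, ← pow_mul, mul_comm (_ + 1), pow_mul,
    (Complex.isPrimitiveRoot_exp n (NeZero.ne n)).pow_eq_one, one_pow, inv_one]

lemma rootInv_injective : Function.Injective (rootInv n) := by
  intro i j h
  have hζ := Complex.isPrimitiveRoot_exp n (NeZero.ne n)
  rw [rootInv, rootInv, inv_inj, pow_succ, pow_succ,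
    mul_left_inj' (hζ.ne_zero (NeZero.ne n))] at h
  exact Fin.ext (hζ.pow_inj i.isLt j.isLt h)

lemma conj_rootInv (i : Fin n) : (starRingEnd ℂ) (rootInv n i) = (rootInv n i)⁻¹ :=
  (Complex.inv_eq_conj (Complex.norm_eq_one_of_pow_eq_one (rootInv_pow i) (NeZero.ne n))).symm

lemma linSubst_rootInv_bijective :
    Function.Bijective (linSubst (Matrix.vandermonde (rootInv n))) :=
  linSubst_bijective (isUnit_iff_ne_zero.2 (Matrix.det_vandermonde_ne_zero_iff.2 rootInv_injective))

lemma sum_mul_rootInv_eq_zero {t : Fin n →₀ ℕ} (h : ∑ i, (t i : ℂ) * (rootInv n i)⁻¹ = 0) :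
    ∑ i, (t i : ℂ) * rootInv n i = 0 := by
  have := congrArg (starRingEnd ℂ) h
  simpa [← conj_rootInv] using this

lemma cyclicDerivationInv_eq_zero {p : MvPolynomial (Fin n) ℂ} (h : cyclicDerivation n p = 0) :
    cyclicDerivationInv n p = 0 := by
  obtain ⟨q, rfl⟩ := linSubst_rootInv_bijective.2 p
  rw [cyclicDerivation_linSubst rootInv_pow,
    map_eq_zero_iff _ linSubst_rootInv_bijective.1, ← zero_smul ℂ q,
    diagDerivation_eq_smul_iff] at h
  rw [cyclicDerivationInv_linSubst rootInv_pow, map_eq_zero_iff _ linSubst_rootInv_bijective.1,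
    ← zero_smul ℂ q, diagDerivation_eq_smul_iff]
  exact fun t ht => sum_mul_rootInv_eq_zero (h t ht)

lemma cyclicDerivation_eq_zero_of_sq {p : MvPolynomial (Fin n) ℂ}
    (h : cyclicDerivation n (cyclicDerivation n p) = 0) : cyclicDerivation n p = 0 := by
  obtain ⟨q, rfl⟩ := linSubst_rootInv_bijective.2 p
  rw [cyclicDerivation_linSubst rootInv_pow, cyclicDerivation_linSubst rootInv_pow,
    map_eq_zero_iff _ linSubst_rootInv_bijective.1] at h
  rw [cyclicDerivation_linSubst rootInv_pow, map_eq_zero_iff _ linSubst_rootInv_bijective.1]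
  ext t
  have := congrArg (coeff t) h
  rw [coeff_diagDerivation, coeff_diagDerivation, coeff_zero] at this
  rw [coeff_diagDerivation, coeff_zero]
  simpa using this

end Cyclic

lemma substDerivation_add (c d : Fin n → ℂ) (τ : Fin n → Fin n) :
    substDerivation (c + d) τ = substDerivation c τ + substDerivation d τ := by
  refine derivation_ext fun i => ?_
  rw [Derivation.add_apply, substDerivation_X, substDerivation_X, substDerivation_X, Pi.add_apply,
    add_smul]

lemma coeff_substDerivation_eq_zero_of_int {c : Fin n → ℂ} {τ : Fin n → Fin n} {s : ℤ}
    (h : ∀ i, c i ≠ 0 → ((τ i : ℕ) : ℤ) = (i : ℕ) + s) {p : MvPolynomial (Fin n) ℂ}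
    {t : Fin n →₀ ℕ}
    (hp : ∀ u, coeff u p ≠ 0 → ∑ i, (u i : ℤ) * (i : ℕ) + s ≠ ∑ i, (t i : ℤ) * (i : ℕ)) :
    coeff t (substDerivation c τ p) = 0 :=
  coeff_substDerivation_eq_zero (l := fun i => ((i : ℕ) : ℂ)) (s := s)
    (fun i hi => by exact_mod_cast h i hi) fun u hu => by exact_mod_cast hp u hu

lemma substDerivation_top_eq_zero {c d : Fin n → ℂ} {τ : Fin n → Fin n} {r s w : ℤ}
    (hc : ∀ i, c i ≠ 0 → ((τ i : ℕ) : ℤ) = (i : ℕ) + s)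
    (hd : ∀ i, d i ≠ 0 → ((τ i : ℕ) : ℤ) = (i : ℕ) + r) (hrs : r < s)
    {p q : MvPolynomial (Fin n) ℂ} (hp : substDerivation (c + d) τ p = 0)
    (hw : ∀ t, coeff t p ≠ 0 → ∑ i, (t i : ℤ) * (i : ℕ) ≤ w)
    (hq : ∀ t, coeff t q = if ∑ i, (t i : ℤ) * (i : ℕ) = w then coeff t p else 0) :
    substDerivation c τ q = 0 := by
  ext t
  rw [coeff_zero]
  by_cases ht : ∑ i, (t i : ℤ) * (i : ℕ) = w + s
  · have h1 := coeff_substDerivation_eq_zero_of_int (p := p) (t := t) hd fun u hu => by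
      have := hw u hu
      lia
    have h2 := coeff_substDerivation_eq_zero_of_int (p := p - q) (t := t) hc fun u hu => by
      rw [coeff_sub, hq] at hu
      intro h
      exact hu (by rw [if_pos (by lia), sub_self])
    rw [substDerivation_add, Derivation.add_apply] at hp
    have h3 := congrArg (coeff t) hp
    rw [coeff_add, h1, add_zero, coeff_zero] at h3
    rw [map_sub, coeff_sub, h3] at h2
    simpa using h2
  · refine coeff_substDerivation_eq_zero_of_int hc fun u hu h => ht ?_
    rw [hq] at hu
    rw [← h, (ite_ne_right_iff.1 hu).1]

variable [NeZero n]

lemma val_add_one_cases (i : Fin n) :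
    ((i : ℕ) + 1 < n ∧ ((i + 1 : Fin n) : ℕ) = i + 1) ∨ ((i : ℕ) + 1 = n ∧ i + 1 = 0) := by
  have h : ((i + 1 : Fin n) : ℕ) = (i + 1) % n := by
    rw [Fin.val_add, Fin.val_one', Nat.add_mod_mod]
  rcases Nat.lt_or_ge ((i : ℕ) + 1) n with h1 | h1
  · exact Or.inl ⟨h1, by rw [h, Nat.mod_eq_of_lt h1]⟩
  · have h2 : (i : ℕ) + 1 = n := le_antisymm i.isLt h1
    exact Or.inr ⟨h2, Fin.ext (by rw [h, h2, Nat.mod_self, Fin.val_zero])⟩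

lemma val_sub_one_of_ne_zero {i : Fin n} (hi : i ≠ 0) : ((i - 1 : Fin n) : ℕ) + 1 = i := by
  rcases val_add_one_cases (i - 1) with h | h
  · rw [← h.2, sub_add_cancel]
  · exact absurd (by simpa using h.2) hi

lemma cyclicDerivation_lowering {p : MvPolynomial (Fin n) ℂ} (hp : cyclicDerivation n p = 0) :
    cyclicDerivation n
        (substDerivation (fun i => ((i : ℕ) : ℂ) * (n - (i : ℕ)) / 2) (fun i => i - 1) p) =
      diagDerivation (fun i => ((i : ℕ) : ℂ) - ((n : ℂ) - 1) / 2) p := by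
  rw [commutator_substDerivation (e := fun i => ((i : ℕ) : ℂ) - ((n : ℂ) - 1) / 2) (υ := id), hp,
    map_zero, zero_add]
  intro i
  simp only [sub_add_cancel, add_sub_cancel_right, ← sub_smul, id]
  congr 1
  rcases val_add_one_cases i with ⟨-, h⟩ | ⟨h, h'⟩
  · rw [h]
    push_cast
    ring
  · have hC : (n : ℂ) = (i : ℕ) + 1 := by exact_mod_cast h.symm
    rw [h', Fin.val_zero, hC]
    push_cast
    ring

/-- The nilpotent derivation `X i ↦ X (i + 1)` for `i < n - 1`, `X (n - 1) ↦ 0`. -/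
noncomputable abbrev raisingDerivation (n : ℕ) [NeZero n] :
    Derivation ℂ (MvPolynomial (Fin n) ℂ) (MvPolynomial (Fin n) ℂ) :=
  substDerivation (fun i => if i + 1 = 0 then 0 else 1) fun i => i + 1

/-- The lowering operator of an `sl₂`-triple acting on the variables `X 1, …, X (n - 1)`. -/
noncomputable abbrev loweringDerivation (n : ℕ) [NeZero n] :
    Derivation ℂ (MvPolynomial (Fin n) ℂ) (MvPolynomial (Fin n) ℂ) :=
  substDerivation (fun i => if i = 0 then 0 else (((i : ℕ) : ℂ) - 1) * (n - (i : ℕ)) / 2)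
    fun i => i - 1

lemma raising_lowering (p : MvPolynomial (Fin n) ℂ) :
    raisingDerivation n (loweringDerivation n p) = loweringDerivation n (raisingDerivation n p) +
      diagDerivation (fun i => if i = 0 then 0 else ((i : ℕ) : ℂ) - (n : ℂ) / 2) p := by
  refine commutator_substDerivation (fun i => ?_) p
  simp only [sub_add_cancel, add_sub_cancel_right, ← sub_smul, id]
  congr 1
  rcases val_add_one_cases i with ⟨h1, h⟩ | ⟨h, h'⟩
  · have h2 : i + 1 ≠ 0 := fun h3 => by simp [h3] at h
    simp only [h2, if_false, h]
    split_ifs with h4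
    · simp [h4]
    · push_cast
      ring
  · simp only [h', if_true]
    split_ifs with h4
    · simp
    · have hC : (n : ℂ) = (i : ℕ) + 1 := by exact_mod_cast h.symm
      rw [hC]
      ring

lemma diagDerivation_eq_zero_of_subst {p : MvPolynomial (Fin n) ℂ}
    (h : substDerivation (fun i => if i = 0 then 1 else 0) (fun i => i - 1) p = 0) :
    diagDerivation (fun i : Fin n => if i = 0 then 1 else 0) p = 0 := by
  have h1 : (X (0 - 1) : MvPolynomial (Fin n) ℂ) •
      diagDerivation (fun i : Fin n => if i = 0 then 1 else 0) =
      (X 0 : MvPolynomial (Fin n) ℂ) •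
        substDerivation (fun i => if i = 0 then 1 else 0) (fun i => i - 1) := by
    refine derivation_ext fun i => ?_
    rw [Derivation.smul_apply, Derivation.smul_apply, substDerivation_X, substDerivation_X, id]
    split_ifs with h
    · rw [h, one_smul, one_smul, smul_eq_mul, smul_eq_mul, mul_comm]
    · rw [zero_smul, zero_smul, smul_zero, smul_zero]
  have h2 := DFunLike.congr_fun h1 p
  rw [Derivation.smul_apply, Derivation.smul_apply, h, smul_zero, smul_eq_mul] at h2
  exact (mul_eq_zero.1 h2).resolve_left (X_ne_zero _)

lemma eq_zero_of_raising_eq_zero {k w : ℕ} (hk : 1 ≤ k) (hw : 2 * w ≤ k * (n - 1))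
    {q : MvPolynomial (Fin n) ℂ} (hq : raisingDerivation n q = 0)
    (h0 : diagDerivation (fun i : Fin n => if i = 0 then 1 else 0) q = (0 : ℂ) • q)
    (h1 : diagDerivation (fun _ : Fin n => 1) q = (k : ℂ) • q)
    (h2 : diagDerivation (fun i : Fin n => ((i : ℕ) : ℂ)) q = (w : ℂ) • q) : q = 0 := by
  set Q : ℕ → MvPolynomial (Fin n) ℂ := fun m => (loweringDerivation n)^[m] q with hQ
  have hsucc : ∀ m, Q (m + 1) = loweringDerivation n (Q m) := fun m =>
    Function.iterate_succ_apply' _ _ _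
  have H0 : ∀ m, diagDerivation (fun i : Fin n => if i = 0 then 1 else 0) (Q m)
      = (0 : ℂ) • Q m := by
    intro m
    induction m with
    | zero => exact h0
    | succ m ih =>
      rw [hsucc, diagDerivation_substDerivation (s := 0) _ ih, add_zero]
      intro i hi
      have h3 : i ≠ 0 := fun h => hi (if_pos h)
      have h4 : i - 1 ≠ 0 := fun h => hi (by
        have := val_sub_one_of_ne_zero h3
        rw [h, Fin.val_zero] at this
        simp [← this])
      rw [if_neg h3, if_neg h4, add_zero]
  have H1 : ∀ m, diagDerivation (fun _ : Fin n => 1) (Q m) = (k : ℂ) • Q m := by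
    intro m
    induction m with
    | zero => exact h1
    | succ m ih =>
      rw [hsucc, diagDerivation_substDerivation (s := 0) _ ih, add_zero]
      exact fun _ _ => (add_zero _).symm
  have H2 : ∀ m, diagDerivation (fun i : Fin n => ((i : ℕ) : ℂ)) (Q m)
      = ((w : ℂ) - m) • Q m := by
    intro m
    induction m with
    | zero =>
      rw [Nat.cast_zero, sub_zero]
      exact h2
    | succ m ih =>
      rw [hsucc, diagDerivation_substDerivation (s := -1) _ ih]
      · congr 1
        push_cast
        ring
      · intro i hi
        have h3 : i ≠ 0 := fun h => hi (if_pos h)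
        rw [← val_sub_one_of_ne_zero h3]
        push_cast
        ring
  have Hdiag : ∀ m, diagDerivation
      (fun i : Fin n => if i = 0 then 0 else ((i : ℕ) : ℂ) - (n : ℂ) / 2) (Q m)
      = ((w : ℂ) - m - k * n / 2) • Q m := by
    intro m
    rw [diagDerivation_eq_smul_iff]
    intro t ht
    have e0 := (diagDerivation_eq_smul_iff _ _ _).1 (H0 m) t ht
    have e1 := (diagDerivation_eq_smul_iff _ _ _).1 (H1 m) t ht
    have e2 := (diagDerivation_eq_smul_iff _ _ _).1 (H2 m) t ht
    have : ∀ i : Fin n, (t i : ℂ) * (if i = 0 then 0 else ((i : ℕ) : ℂ) - (n : ℂ) / 2)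
        = t i * (i : ℕ) - n / 2 * (t i * 1) + n / 2 * (t i * (if i = 0 then 1 else 0)) := by
      intro i
      split_ifs with h
      · simp [h]
      · ring
    rw [Finset.sum_congr rfl fun i _ => this i, Finset.sum_add_distrib, Finset.sum_sub_distrib,
      ← Finset.mul_sum, ← Finset.mul_sum, e0, e1, e2]
    ring
  have hN : ∀ m, raisingDerivation n (Q (m + 1))
      = ((m + 1) * ((w : ℂ) - k * n / 2 - m / 2)) • Q m := by
    intro m
    induction m with
    | zero =>
      rw [hsucc, raising_lowering, Hdiag, show Q 0 = q from rfl, hq, map_zero, zero_add]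
      simp
    | succ m ih =>
      rw [hsucc, raising_lowering, Hdiag, ih, Derivation.map_smul, ← hsucc, ← add_smul]
      congr 1
      push_cast
      ring
  have hdesc : ∀ m, Q (m + 1) = 0 → Q m = 0 := by
    intro m hm
    have h3 := hN m
    rw [hm, map_zero] at h3
    refine (smul_eq_zero.1 h3.symm).resolve_left (mul_ne_zero ?_ ?_)
    · exact_mod_cast m.succ_ne_zero
    · intro h
      have h4 : (2 * w : ℂ) = (k * n + m : ℕ) := by
        push_cast
        linear_combination 2 * h
      have h5 : 2 * w = k * n + m := by exact_mod_cast h4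
      have h6 : k * (n - 1) < k * n :=
        Nat.mul_lt_mul_of_pos_left (Nat.sub_lt (NeZero.pos n) one_pos) hk
      lia
  have htop : Q (w + 1) = 0 := by
    ext t
    rw [coeff_zero]
    by_contra ht
    have h3 := (diagDerivation_eq_smul_iff _ _ _).1 (H2 (w + 1)) t ht
    have h4 : ((∑ i, t i * (i : ℕ) + 1 : ℕ) : ℂ) = (0 : ℕ) := by
      push_cast at h3 ⊢
      rw [h3]
      ring
    exact absurd (Nat.cast_injective h4) (Nat.succ_ne_zero _)
  have : ∀ m, Q m = 0 → Q 0 = 0 := by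
    intro m
    induction m with
    | zero => exact id
    | succ m ih => exact fun h => ih (hdesc m h)
  exact this _ htop

lemma exists_lt_weight {k : ℕ} (hk : 1 ≤ k) {p : MvPolynomial (Fin n) ℂ} (hp : p ≠ 0)
    (hT : cyclicDerivation n p = 0) (hhom : ∀ t, coeff t p ≠ 0 → ∑ i, t i = k) :
    ∃ t, coeff t p ≠ 0 ∧ k * (n - 1) < 2 * ∑ i, t i * (i : ℕ) := by
  obtain ⟨t₀, ht₀, hmax⟩ := Finset.exists_max_image p.support
    (fun t => ∑ i, t i * (i : ℕ)) (support_nonempty.2 hp)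
  refine ⟨t₀, mem_support_iff.1 ht₀, ?_⟩
  by_contra hlt
  set w := ∑ i, t₀ i * (i : ℕ) with hw
  set q := weightedHomogeneousComponent (fun i : Fin n => (i : ℕ)) w p with hq
  have hcoeff : ∀ t, coeff t q = if ∑ i, t i * (i : ℕ) = w then coeff t p else 0 := by
    intro t
    rw [hq, coeff_weightedHomogeneousComponent, Finsupp.weight_apply,
      Finsupp.sum_fintype _ _ (by simp)]
    rfl
  have hcoeff' : ∀ t, coeff t q = if ∑ i, (t i : ℤ) * (i : ℕ) = (w : ℤ) then coeff t p else 0 := by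
    intro t
    rw [hcoeff]
    norm_cast
  have hwt : ∀ t, coeff t p ≠ 0 → ∑ i, (t i : ℤ) * (i : ℕ) ≤ (w : ℤ) := by
    intro t ht
    exact_mod_cast hmax t (mem_support_iff.2 ht)
  have hmem : ∀ t, coeff t q ≠ 0 → ∑ i, t i * (i : ℕ) = w ∧ coeff t p ≠ 0 := by
    intro t ht
    rw [hcoeff] at ht
    exact ite_ne_right_iff.1 ht
  refine absurd ?_ (mem_support_iff.1 ht₀)
  suffices q = 0 by
    have := hcoeff t₀
    rw [if_pos rfl] at this
    rw [← this, ‹q = 0›, coeff_zero]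
  refine eq_zero_of_raising_eq_zero hk (not_lt.1 hlt) ?_ ?_ ?_ ?_
  · refine substDerivation_top_eq_zero (d := fun i => if i + 1 = 0 then 1 else 0) (s := 1)
      (r := 1 - n) (fun i hi => ?_) (fun i hi => ?_) ?_ (p := p) ?_ hwt hcoeff'
    · have hi' : i + 1 ≠ 0 := fun h => hi (if_pos h)
      rcases val_add_one_cases i with h | h
      · exact_mod_cast h.2
      · exact absurd h.2 hi'
    · have hi' : i + 1 = 0 := (ite_ne_right_iff.1 hi).1
      rcases val_add_one_cases i with h | h
      · rw [hi', Fin.val_zero] at h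
        lia
      · rw [hi', Fin.val_zero]
        lia
    · have := NeZero.pos n
      lia
    · convert hT using 2
      congr 1
      funext i
      simp only [Pi.add_apply]
      split_ifs <;> simp
  · rw [zero_smul]
    refine diagDerivation_eq_zero_of_subst ?_
    refine substDerivation_top_eq_zero (d := fun i => if i = 0 then 0 else 1) (s := n - 1)
      (r := -1) (fun i hi => ?_) (fun i hi => ?_) ?_ (p := p) ?_ hwt hcoeff'
    · have hi' : i = 0 := (ite_ne_right_iff.1 hi).1
      rcases val_add_one_cases (i - 1) with h | h
      · rw [sub_add_cancel, hi', Fin.val_zero] at h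
        lia
      · rw [hi', Fin.val_zero] at *
        lia
    · have hi' : i ≠ 0 := fun h => hi (if_pos h)
      rw [← val_sub_one_of_ne_zero hi']
      push_cast
      ring
    · have := NeZero.pos n
      lia
    · convert cyclicDerivationInv_eq_zero hT using 2
      congr 1
      funext i
      simp only [Pi.add_apply]
      split_ifs <;> simp
  · rw [diagDerivation_eq_smul_iff]
    intro t ht
    simp only [mul_one]
    exact_mod_cast hhom t (hmem t ht).2
  · rw [diagDerivation_eq_smul_iff]
    intro t ht
    exact_mod_cast (hmem t ht).1

end MvPolynomial

namespace PIdx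

variable {n k : ℕ}

/-- The exponent of the monomial `u_a`. -/
noncomputable def toFinsupp (a : PIdx n k) : Fin n →₀ ℕ :=
  Finsupp.equivFunOnFinite.symm fun i => (a.1 i : ℕ)

lemma toFinsupp_apply (a : PIdx n k) (i : Fin n) : a.toFinsupp i = a.1 i := rfl

lemma sum_toFinsupp (a : PIdx n k) : ∑ i, a.toFinsupp i = k := a.2

lemma toFinsupp_injective : Function.Injective (toFinsupp : PIdx n k → Fin n →₀ ℕ) := by
  intro a b h
  refine Subtype.ext (funext fun i => Fin.ext ?_)
  exact DFunLike.congr_fun h i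

lemma exists_toFinsupp_eq {t : Fin n →₀ ℕ} (ht : ∑ i, t i = k) :
    ∃ a : PIdx n k, a.toFinsupp = t :=
  ⟨⟨fun i => ⟨t i, Nat.lt_succ_of_le
    (ht ▸ Finset.single_le_sum (fun _ _ => Nat.zero_le _) (Finset.mem_univ i))⟩, ht⟩,
    Finsupp.ext fun _ => rfl⟩

lemma card_eq (n k : ℕ) : Fintype.card (PIdx n k) = (k + n - 1).choose k := by
  have h : Finset.univ.map ⟨_, toFinsupp_injective (n := n) (k := k)⟩ =
      Finset.finsuppAntidiag Finset.univ k := by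
    ext t
    simp only [Finset.mem_map, Finset.mem_univ, true_and, Function.Embedding.coeFn_mk,
      Finset.mem_finsuppAntidiag, Finset.subset_univ, and_true]
    exact ⟨fun ⟨a, ha⟩ => ha ▸ a.sum_toFinsupp, exists_toFinsupp_eq⟩
  rw [Fintype.card, ← Finset.card_map, h, Finset.card_finsuppAntidiag_nat_eq_choose,
    Finset.card_univ, Fintype.card_fin, add_comm]

/-- The homogeneous polynomial with coefficient vector `P`. -/
noncomputable def toPoly : (PIdx n k → ℂ) →ₗ[ℂ] MvPolynomial (Fin n) ℂ :=
  Fintype.linearCombination ℂ fun b => MvPolynomial.monomial b.toFinsupp (1 : ℂ)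

lemma toPoly_apply (P : PIdx n k → ℂ) :
    toPoly P = ∑ b, P b • MvPolynomial.monomial b.toFinsupp (1 : ℂ) :=
  Fintype.linearCombination_apply _ _ _

lemma coeff_toPoly (P : PIdx n k → ℂ) (b : PIdx n k) :
    MvPolynomial.coeff b.toFinsupp (toPoly P) = P b := by
  classical
  simp only [toPoly_apply, MvPolynomial.coeff_sum, MvPolynomial.coeff_smul,
    MvPolynomial.coeff_monomial, toFinsupp_injective.eq_iff]
  simp

lemma toPoly_injective : Function.Injective (toPoly : (PIdx n k → ℂ) →ₗ[ℂ] _) := by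
  intro P Q h
  funext b
  rw [← coeff_toPoly P, h, coeff_toPoly]

lemma sum_eq_of_coeff_toPoly {P : PIdx n k → ℂ} {t : Fin n →₀ ℕ}
    (ht : MvPolynomial.coeff t (toPoly P) ≠ 0) : ∑ i, t i = k := by
  classical
  simp only [toPoly_apply, MvPolynomial.coeff_sum, MvPolynomial.coeff_smul,
    MvPolynomial.coeff_monomial] at ht
  obtain ⟨b, -, hb⟩ := Finset.exists_ne_zero_of_sum_ne_zero ht
  rw [← b.sum_toFinsupp]
  congr 1
  by_contra h
  exact hb (by rw [if_neg (fun h' => h (by rw [h'])), smul_zero])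

lemma diagDerivation_one_toPoly (P : PIdx n k → ℂ) :
    MvPolynomial.diagDerivation (fun _ => 1) (toPoly P) = (k : ℂ) • toPoly P := by
  rw [MvPolynomial.diagDerivation_eq_smul_iff]
  intro t ht
  simp only [mul_one]
  exact_mod_cast sum_eq_of_coeff_toPoly ht

lemma toPoly_coeff {p : MvPolynomial (Fin n) ℂ}
    (hp : MvPolynomial.diagDerivation (fun _ => 1) p = (k : ℂ) • p) :
    toPoly (fun b : PIdx n k => MvPolynomial.coeff b.toFinsupp p) = p := by
  rw [MvPolynomial.diagDerivation_eq_smul_iff] at hp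
  ext t
  by_cases ht : ∑ i, t i = k
  · obtain ⟨b, rfl⟩ := exists_toFinsupp_eq ht
    rw [coeff_toPoly]
  · have h1 : MvPolynomial.coeff t p = 0 := by
      by_contra h
      have := hp t h
      simp only [mul_one] at this
      exact ht (by exact_mod_cast this)
    rw [h1]
    by_contra h
    exact ht (sum_eq_of_coeff_toPoly h)

lemma diagDerivation_one_substDerivation (c : Fin n → ℂ) (τ : Fin n → Fin n)
    (P : PIdx n k → ℂ) :
    MvPolynomial.diagDerivation (fun _ => 1) (MvPolynomial.substDerivation c τ (toPoly P)) =
      (k : ℂ) • MvPolynomial.substDerivation c τ (toPoly P) := by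
  have := MvPolynomial.diagDerivation_substDerivation (c := c) (τ := τ) (s := 0)
    (fun _ _ => (add_zero _).symm) (diagDerivation_one_toPoly P)
  rwa [add_zero] at this

/-- The contribution of the factor `v_i` of `u_a` to the `u_b`-coefficient of `D u_a`, up to
the power of `z`. -/
noncomputable def stepCoeff (i : Fin n) (b a : PIdx n k) : ℂ :=
  if 1 ≤ (a.1 i : ℕ) ∧
      (fun l : Fin n => (a.1 l : ℕ) + (if (l : ℕ) = ((i : ℕ) + 1) % n then 1 else 0)
        - (if l = i then 1 else 0)) = (fun l : Fin n => (b.1 l : ℕ)) then ((a.1 i : ℕ) : ℂ) else 0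

variable [NeZero n]

lemma step_iff (i : Fin n) (b a : PIdx n k) :
    (1 ≤ (a.1 i : ℕ) ∧
      (fun l : Fin n => (a.1 l : ℕ) + (if (l : ℕ) = ((i : ℕ) + 1) % n then 1 else 0)
        - (if l = i then 1 else 0)) = (fun l : Fin n => (b.1 l : ℕ))) ↔
    1 ≤ a.toFinsupp i ∧
      a.toFinsupp + Finsupp.single (i + 1) 1 = b.toFinsupp + Finsupp.single i 1 := by
  refine and_congr_right fun hi => ?_
  rw [funext_iff, DFunLike.ext_iff]
  refine forall_congr' fun l => ?_
  have h : ((l : ℕ) = ((i : ℕ) + 1) % n) ↔ i + 1 = l := by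
    rw [eq_comm, Fin.ext_iff, Fin.val_add, Fin.val_one', Nat.add_mod_mod]
  simp only [h, Finsupp.add_apply, Finsupp.single_apply, toFinsupp_apply, eq_comm (a := l)]
  by_cases hl : i = l
  · subst hl
    simp only [if_true]
    lia
  · simp only [if_neg hl]
    lia

lemma coeff_cyclicDerivation_monomial (b a : PIdx n k) :
    MvPolynomial.coeff b.toFinsupp
      (MvPolynomial.cyclicDerivation n (MvPolynomial.monomial a.toFinsupp 1)) =
      ∑ i, stepCoeff i b a := by
  rw [MvPolynomial.coeff_substDerivation_monomial]
  refine Finset.sum_congr rfl fun i _ => ?_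
  rw [stepCoeff, if_congr (step_iff i b a) rfl rfl, toFinsupp_apply, one_mul, mul_one]

/-- The part of the connection matrix that is constant in `z`. -/
noncomputable def matrixN (n k : ℕ) : Matrix (PIdx n k) (PIdx n k) ℂ :=
  Matrix.of fun b a => ∑ i : Fin n, if (i : ℕ) = n - 1 then 0 else stepCoeff i b a

/-- The part of the connection matrix that is linear in `z`. -/
noncomputable def matrixL (n k : ℕ) : Matrix (PIdx n k) (PIdx n k) ℂ :=
  Matrix.of fun b a => ∑ i : Fin n, if (i : ℕ) = n - 1 then stepCoeff i b a else 0

lemma toPoly_mulVecLin (P : PIdx n k → ℂ) :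
    toPoly ((matrixN n k + matrixL n k).mulVecLin P) =
      MvPolynomial.cyclicDerivation n (toPoly P) := by
  rw [← toPoly_coeff (diagDerivation_one_substDerivation _ _ P)]
  congr 1
  funext b
  rw [toPoly_apply, map_sum, MvPolynomial.coeff_sum, Matrix.mulVecLin_apply, Matrix.mulVec,
    dotProduct]
  refine Finset.sum_congr rfl fun a _ => ?_
  rw [Derivation.map_smul, MvPolynomial.coeff_smul, coeff_cyclicDerivation_monomial, smul_eq_mul,
    mul_comm, Matrix.add_apply, matrixN, matrixL, Matrix.of_apply, Matrix.of_apply]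
  rw [← Finset.sum_add_distrib]
  congr 1
  refine Finset.sum_congr rfl fun i _ => ?_
  split_ifs <;> simp

/-- The weight `∑ i, i * a_i` of `u_a`. -/
def weight (a : PIdx n k) : ℕ := ∑ i : Fin n, (a.1 i : ℕ) * i

lemma weight_add_of_stepCoeff_ne_zero {i : Fin n} {b a : PIdx n k} (h : stepCoeff i b a ≠ 0) :
    weight b + i = weight a + (i + 1 : Fin n) := by
  have h1 := ((step_iff i b a).1 (ite_ne_right_iff.1 h).1).2
  have h2 := congrArg (fun t : Fin n →₀ ℕ => ∑ l, t l * (l : ℕ)) h1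
  simp only [Finsupp.add_apply, add_mul, Finset.sum_add_distrib, Finsupp.single_apply, ite_mul,
    one_mul, zero_mul, Finset.sum_ite_eq, Finset.mem_univ, if_true] at h2
  exact h2.symm

lemma mem_ker_iff (P : PIdx n k → ℂ) :
    P ∈ LinearMap.ker (matrixN n k + matrixL n k).mulVecLin ↔
      MvPolynomial.cyclicDerivation n (toPoly P) = 0 := by
  rw [LinearMap.mem_ker, ← map_eq_zero_iff _ toPoly_injective, toPoly_mulVecLin]

end PIdx

/-- `Sym^k Ai_n` as a graded connection. -/
noncomputable def symAiry (n k : ℕ) [NeZero n] (hk : 1 ≤ k) : GradedConnection (PIdx n k) where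
  n := n
  n_pos := NeZero.pos n
  c := k * (n - 1)
  wt := PIdx.weight
  N := PIdx.matrixN n k
  L := PIdx.matrixL n k
  N_wt a b h := by
    rw [PIdx.matrixN, Matrix.of_apply] at h
    obtain ⟨i, -, hi⟩ := Finset.exists_ne_zero_of_sum_ne_zero h
    rw [ite_ne_left_iff] at hi
    have h1 := PIdx.weight_add_of_stepCoeff_ne_zero hi.2.symm
    have h2 := NeZero.pos n
    rcases MvPolynomial.val_add_one_cases i with h | h <;> lia
  L_wt a b h := by
    rw [PIdx.matrixL, Matrix.of_apply] at h
    obtain ⟨i, -, hi⟩ := Finset.exists_ne_zero_of_sum_ne_zero h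
    rw [ite_ne_right_iff] at hi
    have h1 := PIdx.weight_add_of_stepCoeff_ne_zero hi.2
    have h2 := NeZero.pos n
    rcases MvPolynomial.val_add_one_cases i with h | h
    · lia
    · rw [h.2, Fin.val_zero] at h1
      lia
  isCompl := by
    refine (Submodule.isCompl_iff_disjoint _ _ ?_).2 ?_
    · rw [add_comm, LinearMap.finrank_range_add_finrank_ker]
    · rw [Submodule.disjoint_def]
      rintro _ h ⟨P, rfl⟩
      rw [PIdx.mem_ker_iff, PIdx.toPoly_mulVecLin] at h
      exact (PIdx.mem_ker_iff P).2 (MvPolynomial.cyclicDerivation_eq_zero_of_sq h)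
  weight_mem_range P hP := by
    rw [PIdx.mem_ker_iff] at hP
    have h := MvPolynomial.cyclicDerivation_lowering hP
    refine ⟨fun b => MvPolynomial.coeff b.toFinsupp (MvPolynomial.substDerivation
      (fun i => ((i : ℕ) : ℂ) * (n - (i : ℕ)) / 2) (fun i => i - 1) (PIdx.toPoly P)),
      PIdx.toPoly_injective ?_⟩
    rw [PIdx.toPoly_mulVecLin, PIdx.toPoly_coeff (PIdx.diagDerivation_one_substDerivation _ _ P), h,
      ← PIdx.toPoly_coeff (PIdx.diagDerivation_one_substDerivation _ _ P)]
    congr 1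
    funext b
    rw [MvPolynomial.coeff_diagDerivation, PIdx.coeff_toPoly]
    congr 1
    simp only [mul_sub, Finset.sum_sub_distrib, ← Finset.sum_mul]
    have h1 : ∑ i, (b.toFinsupp i : ℂ) = k := by exact_mod_cast b.sum_toFinsupp
    rw [h1, PIdx.weight, Nat.cast_mul, Nat.cast_sub (NeZero.pos n)]
    push_cast
    simp only [PIdx.toFinsupp_apply]
    ring
  exists_wt_lt P hP h0 := by
    rw [PIdx.mem_ker_iff] at hP
    obtain ⟨t, ht, hlt⟩ := MvPolynomial.exists_lt_weight hk
      ((map_ne_zero_iff _ PIdx.toPoly_injective).2 h0) hP fun t => PIdx.sum_eq_of_coeff_toPoly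
    obtain ⟨b, rfl⟩ := PIdx.exists_toFinsupp_eq (PIdx.sum_eq_of_coeff_toPoly ht)
    exact ⟨b, by rwa [PIdx.coeff_toPoly] at ht, hlt⟩

lemma AiD_eq_symAiry_D (n k : ℕ) [NeZero n] (hk : 1 ≤ k) : AiD n k = (symAiry n k hk).D := by
  refine LinearMap.ext fun f => funext fun b => ?_
  simp only [AiD, GradedConnection.D, LinearMap.pi_apply, LinearMap.add_apply,
    LinearMap.comp_apply, LinearMap.proj_apply, LinearMap.sum_apply, LinearMap.mulLeft_apply]
  congr 1
  refine Finset.sum_congr rfl fun a _ => ?_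
  simp only [symAiry, PIdx.matrixN, PIdx.matrixL, Matrix.of_apply, map_sum, Finset.sum_mul,
    ← Finset.sum_add_distrib]
  refine Finset.sum_congr rfl fun i _ => ?_
  simp only [PIdx.stepCoeff]
  split_ifs <;> simp [mul_assoc]

/-- The eigenvalues of the cyclic derivation on `Sym^k`. -/
noncomputable def symEigenvalue {n k : ℕ} (a : PIdx n k) : ℂ :=
  ∑ i, (a.toFinsupp i : ℂ) * (MvPolynomial.rootInv n i)⁻¹

lemma finrank_ker_T (n k : ℕ) [NeZero n] (hk : 1 ≤ k) :
    Module.finrank ℂ (LinearMap.ker (symAiry n k hk).T) =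
      Nat.card {a : PIdx n k // symEigenvalue a = 0} := by
  set V := Matrix.vandermonde (MvPolynomial.rootInv n) with hV
  have hinj := (MvPolynomial.linSubst_rootInv_bijective (n := n)).1
  set Δ := (Matrix.diagonal (symEigenvalue (n := n) (k := k))).mulVecLin with hΔ
  let B : (PIdx n k → ℂ) →ₗ[ℂ] (PIdx n k → ℂ) :=
    (LinearMap.pi fun b => MvPolynomial.lcoeff ℂ b.toFinsupp) ∘ₗ
      (MvPolynomial.linSubst V).toLinearMap ∘ₗ PIdx.toPoly
  have hB : ∀ P, PIdx.toPoly (B P) = MvPolynomial.linSubst V (PIdx.toPoly P) := fun P =>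
    PIdx.toPoly_coeff (by
      change MvPolynomial.diagDerivation _ (MvPolynomial.linSubst V (PIdx.toPoly P)) =
        (k : ℂ) • MvPolynomial.linSubst V (PIdx.toPoly P)
      rw [MvPolynomial.diagDerivation_one_linSubst, PIdx.diagDerivation_one_toPoly, map_smul])
  have hBinj : Function.Injective B := by
    intro P Q h
    have := congrArg PIdx.toPoly h
    rw [hB, hB] at this
    exact PIdx.toPoly_injective (hinj this)
  have hker : ∀ P, B P ∈ LinearMap.ker (symAiry n k hk).T ↔ P ∈ LinearMap.ker Δ := by
    intro P
    refine (PIdx.mem_ker_iff (B P)).trans ?_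
    rw [hB, MvPolynomial.cyclicDerivation_linSubst MvPolynomial.rootInv_pow,
      map_eq_zero_iff _ hinj, ← PIdx.toPoly_coeff (PIdx.diagDerivation_one_substDerivation _ _ P),
      map_eq_zero_iff _ PIdx.toPoly_injective, LinearMap.mem_ker, hΔ, Matrix.mulVecLin_apply]
    simp only [funext_iff, Matrix.mulVec_diagonal, MvPolynomial.coeff_diagDerivation,
      PIdx.coeff_toPoly]
    rfl
  let e := LinearEquiv.ofInjectiveEndo B hBinj
  have hmap : LinearMap.ker (symAiry n k hk).T = (LinearMap.ker Δ).map (e : _ →ₗ[ℂ] _) := by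
    ext P
    obtain ⟨Q, rfl⟩ := e.surjective P
    rw [Submodule.mem_map_equiv, e.symm_apply_apply]
    exact hker Q
  rw [hmap, LinearEquiv.finrank_map_eq, Nat.card_eq_fintype_card]
  have h1 := LinearMap.finrank_range_add_finrank_ker Δ
  have h2 := Matrix.rank_diagonal (symEigenvalue (n := n) (k := k))
  have h3 := Fintype.card_subtype_compl fun a : PIdx n k => symEigenvalue a = 0
  have h4 := Fintype.card_subtype_le fun a : PIdx n k => symEigenvalue a = 0
  rw [Matrix.rank] at h2
  rw [Module.finrank_fintype_fun_eq_card, h2] at h1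
  lia

/-- `dim_ℂ H¹_dR(𝔸¹, Sym^k Ai_n) = (1/n)·C(k+n−1, k) − ((n+1)/n)·S_{n,k}` as rational numbers,
where `H¹_dR(𝔸¹, Sym^k Ai_n) = coker(D)` and
`S_{n,k} = #{a ∈ P(n,k) : Σ_i a_i·ζ_n^{i+1} = 0}`, `ζ_n = exp(2πi/n)`. -/
theorem stmt_0 (n k : ℕ) (hn : 2 ≤ n) (hk : 1 ≤ k) :
    FiniteDimensional ℂ (AiSym n k ⧸ LinearMap.range (AiD n k))
    ∧ (Module.finrank ℂ (AiSym n k ⧸ LinearMap.range (AiD n k)) : ℚ)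
        = 1 / (n : ℚ) * ((k + n - 1).choose k : ℚ)
          - ((n : ℚ) + 1) / (n : ℚ) *
            (Nat.card {a : PIdx n k //
                ∑ i, ((a.1 i : ℕ) : ℂ)
                  * Complex.exp (2 * (Real.pi : ℂ) * Complex.I / (n : ℂ)) ^ ((i : ℕ) + 1)
                  = 0} : ℚ) := by
  have : NeZero n := ⟨by lia⟩
  have h1 := (symAiry n k hk).finiteDimensional_coker
  have h2 := (symAiry n k hk).finrank_coker
  rw [← AiD_eq_symAiry_D] at h1 h2
  refine ⟨h1, ?_⟩
  rw [finrank_ker_T, PIdx.card_eq] at h2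
  have h3 : ∀ a : PIdx n k, symEigenvalue a = ∑ i, ((a.1 i : ℕ) : ℂ)
      * Complex.exp (2 * (Real.pi : ℂ) * Complex.I / (n : ℂ)) ^ ((i : ℕ) + 1) := by
    intro a
    simp only [symEigenvalue, MvPolynomial.rootInv, inv_inv, PIdx.toFinsupp_apply]
  simp only [h3] at h2
  have hn0 : (n : ℚ) ≠ 0 := by exact_mod_cast NeZero.ne n
  change n * Module.finrank ℂ (AiSym n k ⧸ LinearMap.range (AiD n k)) + (n + 1) * _ = _ at h2
  generalize Module.finrank ℂ (AiSym n k ⧸ LinearMap.range (AiD n k)) = d at h2 ⊢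
  generalize Nat.card _ = S at h2 ⊢
  rw [← h2]
  push_cast
  field_simp
  ring
end

section
/- The operator D : Sym^k Ai_n → Sym^k Ai_n is injective; equivalently, the de Rham cohomology H^0_dR(𝔸¹, Sym^k Ai_n) vanishes (so H^r_dR(𝔸¹, Sym^k Ai_n) = 0 for all r ≠ 1). -/
open Polynomial

namespace MvPolynomial.GeneralizedAiry

open ComplexConjugate

section Fischer

variable {σ : Type*} (ρ : σ → ℝ)

/-- The Fischer weight `a! · ρ^a` of a monomial. -/
noncomputable def fischerWeight (a : σ →₀ ℕ) : ℝ := a.prod fun i c => c.factorial * ρ i ^ c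

/-- The Fischer form `⟨p, q⟩ = ∑ₐ a! ρ^a pₐ conj(qₐ)`. -/
noncomputable def fischer (q : MvPolynomial σ ℂ) : MvPolynomial σ ℂ →ₗ[ℂ] ℂ :=
  (basisMonomials σ ℂ).constr ℂ fun a => fischerWeight ρ a * conj (coeff a q)

variable {ρ}

theorem fischer_monomial (q : MvPolynomial σ ℂ) (a : σ →₀ ℕ) (c : ℂ) :
    fischer ρ q (monomial a c) = c * (fischerWeight ρ a * conj (coeff a q)) := by
  have h : monomial a c = c • basisMonomials σ ℂ a := by
    simp [coe_basisMonomials, smul_monomial]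
  rw [h, map_smul, fischer, Module.Basis.constr_basis, smul_eq_mul]

theorem fischer_self (p : MvPolynomial σ ℂ) :
    fischer ρ p p = ((∑ a ∈ p.support, fischerWeight ρ a * ‖coeff a p‖ ^ 2 : ℝ) : ℂ) := by
  refine (congrArg (fischer ρ p) p.as_sum).trans ?_
  rw [map_sum, Complex.ofReal_sum]
  refine Finset.sum_congr rfl fun a _ => ?_
  rw [fischer_monomial, mul_left_comm, Complex.mul_conj']
  push_cast
  ring

theorem fischerWeight_pos (hρ : ∀ i, 0 < ρ i) (a : σ →₀ ℕ) : 0 < fischerWeight ρ a :=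
  Finset.prod_pos fun i _ => by have := hρ i; positivity

theorem fischer_self_nonneg (hρ : ∀ i, 0 < ρ i) (p : MvPolynomial σ ℂ) :
    0 ≤ (fischer ρ p p).re := by
  rw [fischer_self, Complex.ofReal_re]
  exact Finset.sum_nonneg fun a _ => mul_nonneg (fischerWeight_pos hρ a).le (by positivity)

theorem eq_zero_of_fischer_self (hρ : ∀ i, 0 < ρ i) {p : MvPolynomial σ ℂ}
    (h : (fischer ρ p p).re = 0) : p = 0 := by
  rw [fischer_self, Complex.ofReal_re, Finset.sum_eq_zero_iff_of_nonneg
    fun a _ => mul_nonneg (fischerWeight_pos hρ a).le (by positivity)] at h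
  ext a
  by_contra ha
  have := h a (mem_support_iff.2 ha)
  simp [(fischerWeight_pos hρ a).ne'] at this
  exact ha this

theorem fischerWeight_add_single (a : σ →₀ ℕ) (i : σ) :
    fischerWeight ρ (a + Finsupp.single i 1) = fischerWeight ρ a * ((a i + 1) * ρ i) := by
  classical
  set s := insert i a.support
  have hs : (a + Finsupp.single i 1).support ⊆ s := by
    intro l hl
    by_cases h : l = i
    · simp [s, h]
    · simpa [s, h, Finsupp.single_apply, Ne.symm h] using hl
  rw [fischerWeight, fischerWeight, Finsupp.prod_of_support_subset _ hs _ (by simp),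
    Finsupp.prod_of_support_subset a (Finset.subset_insert _ _) _ (by simp),
    ← Finset.mul_prod_erase s _ (Finset.mem_insert_self i _),
    ← Finset.mul_prod_erase s _ (Finset.mem_insert_self i _)]
  have : ∀ l ∈ s.erase i, (((a + Finsupp.single i 1 : σ →₀ ℕ) l).factorial : ℝ) *
      ρ l ^ (a + Finsupp.single i 1 : σ →₀ ℕ) l = (a l).factorial * ρ l ^ a l := fun l hl => by
    simp [(Finset.ne_of_mem_erase hl).symm]
  rw [Finset.prod_congr rfl this]
  simp [Nat.factorial_succ, pow_succ]
  ring

theorem fischer_sum_smul {ι : Type*} (s : Finset ι) (r : ι → ℝ) (q : ι → MvPolynomial σ ℂ)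
    (p : MvPolynomial σ ℂ) :
    fischer ρ (∑ i ∈ s, (r i : ℂ) • q i) p = ∑ i ∈ s, r i * fischer ρ (q i) p := by
  induction p using MvPolynomial.induction_on' with
  | add p₁ p₂ h₁ h₂ => simp only [map_add, h₁, h₂, mul_add, Finset.sum_add_distrib]
  | monomial a c =>
    simp only [fischer_monomial, coeff_sum, coeff_smul, map_sum, Finset.mul_sum, smul_eq_mul,
      map_mul, Complex.conj_ofReal]
    exact Finset.sum_congr rfl fun i _ => by ring

theorem fischer_sum {ι : Type*} (s : Finset ι) (q : ι → MvPolynomial σ ℂ)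
    (p : MvPolynomial σ ℂ) :
    fischer ρ (∑ i ∈ s, q i) p = ∑ i ∈ s, fischer ρ (q i) p := by
  simpa using fischer_sum_smul (ρ := ρ) s (fun _ => 1) q p

theorem fischer_zero (p : MvPolynomial σ ℂ) : fischer ρ 0 p = 0 := by
  simpa using fischer_sum (ρ := ρ) (∅ : Finset σ) (fun _ => 0) p

theorem fischer_X_mul (i : σ) (p q : MvPolynomial σ ℂ) :
    fischer ρ q (X i * p) = ρ i * fischer ρ (pderiv i q) p := by
  induction p using MvPolynomial.induction_on' with
  | add p₁ p₂ h₁ h₂ => rw [mul_add, map_add, map_add, h₁, h₂, mul_add]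
  | monomial a c =>
    rw [X, monomial_mul, one_mul, fischer_monomial, fischer_monomial, coeff_pderiv,
      add_comm (Finsupp.single i 1), fischerWeight_add_single]
    simp
    ring

theorem fischer_pderiv (i : σ) (p q : MvPolynomial σ ℂ) :
    ρ i * fischer ρ q (pderiv i p) = fischer ρ (X i * q) p := by
  classical
  induction p using MvPolynomial.induction_on' with
  | add p₁ p₂ h₁ h₂ => rw [map_add, map_add, map_add, mul_add, h₁, h₂]
  | monomial a c =>
    rw [pderiv_monomial, fischer_monomial, fischer_monomial, coeff_X_mul']
    split_ifs with h
    · have h' : a i ≠ 0 := Finsupp.mem_support_iff.1 h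
      obtain ⟨b, rfl⟩ : ∃ b, a = b + Finsupp.single i 1 :=
        ⟨a - Finsupp.single i 1, (Finsupp.sub_add_single_one_cancel h').symm⟩
      rw [fischerWeight_add_single, add_tsub_cancel_right]
      simp
      ring
    · simp [Finsupp.notMem_support_iff.1 h]

end Fischer

section Operators

variable {σ : Type*}

theorem derivation_sum_apply {ι : Type*} (s : Finset ι)
    (D : ι → Derivation ℂ (MvPolynomial σ ℂ) (MvPolynomial σ ℂ)) (p : MvPolynomial σ ℂ) :
    (∑ i ∈ s, D i) p = ∑ i ∈ s, D i p :=
  (congrFun (map_sum (Derivation.coeFnAddMonoidHom (R := ℂ) (A := MvPolynomial σ ℂ)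
    (M := MvPolynomial σ ℂ)) D s) p).trans (Finset.sum_apply _ _ _)

theorem derivation_map_finsum {ι : Type*} {A : ι → MvPolynomial σ ℂ}
    (hA : (Function.support A).Finite)
    (D : Derivation ℂ (MvPolynomial σ ℂ) (MvPolynomial σ ℂ)) :
    D (∑ᶠ i, A i) = ∑ᶠ i, D (A i) :=
  (D : MvPolynomial σ ℂ →ₗ[ℂ] MvPolynomial σ ℂ).toAddMonoidHom.map_finsum hA

/-- The vector field `X_i ∂_j`. -/
noncomputable def elem (i j : σ) : Derivation ℂ (MvPolynomial σ ℂ) (MvPolynomial σ ℂ) :=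
  (X i : MvPolynomial σ ℂ) • pderiv j

theorem elem_apply (i j : σ) (p : MvPolynomial σ ℂ) : elem i j p = X i * pderiv j p := rfl

theorem elem_X [DecidableEq σ] (i j l : σ) :
    elem i j (X l) = if l = j then X i else (0 : MvPolynomial σ ℂ) := by
  rw [elem_apply, pderiv_X, Pi.single_apply]
  split_ifs <;> simp

theorem fischer_elem (ρ : σ → ℝ) (i j : σ) (p q : MvPolynomial σ ℂ) :
    ρ j * fischer ρ q (elem i j p) = ρ i * fischer ρ (elem j i q) p := by
  rw [elem_apply, elem_apply, fischer_X_mul, ← fischer_pderiv j]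
  ring

theorem elem_monomial_of_eq_zero {i j : σ} {a : σ →₀ ℕ} (h : a j = 0) (c : ℂ) :
    elem i j (monomial a c) = 0 := by
  simp [elem_apply, h]

theorem elem_monomial (i j : σ) (a : σ →₀ ℕ) (c : ℂ) :
    elem i j (monomial a c) =
      monomial (a - Finsupp.single j 1 + Finsupp.single i 1) (c * a j) := by
  rw [elem_apply, pderiv_monomial, X, monomial_mul, one_mul, add_comm]

theorem weightedHomogeneousComponent_monomial (w : σ → ℤ) (s : ℤ) (a : σ →₀ ℕ) (c : ℂ) :
    weightedHomogeneousComponent w s (monomial a c) =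
      if Finsupp.weight w a = s then monomial a c else 0 := by
  classical
  ext b
  rw [coeff_weightedHomogeneousComponent]
  by_cases hb : a = b
  · subst hb
    split_ifs <;> simp
  · split_ifs <;> simp [coeff_monomial, hb]

theorem weightedHomogeneousComponent_elem (w : σ → ℤ) (s : ℤ) (i j : σ)
    (p : MvPolynomial σ ℂ) :
    weightedHomogeneousComponent w s (elem i j p) =
      elem i j (weightedHomogeneousComponent w (s - w i + w j) p) := by
  induction p using MvPolynomial.induction_on' with
  | add p q hp hq => simp only [map_add, hp, hq]
  | monomial a c =>
    by_cases h : a j = 0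
    · rw [elem_monomial_of_eq_zero h, map_zero, weightedHomogeneousComponent_monomial]
      split_ifs
      · rw [elem_monomial_of_eq_zero h]
      · rw [map_zero]
    · obtain ⟨b, rfl⟩ : ∃ b, a = b + Finsupp.single j 1 :=
        ⟨a - Finsupp.single j 1, (Finsupp.sub_add_single_one_cancel h).symm⟩
      rw [elem_monomial, add_tsub_cancel_right, weightedHomogeneousComponent_monomial,
        weightedHomogeneousComponent_monomial]
      simp only [map_add, Finsupp.weight_single, one_smul]
      by_cases hw : Finsupp.weight w b + w i = s
      · rw [if_pos hw, if_pos (by omega), elem_monomial, add_tsub_cancel_right]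
      · rw [if_neg hw, if_neg (by omega), map_zero]

/-- The Euler field `∑ wᵢ Xᵢ∂ᵢ` of a weight function. -/
noncomputable def euler [Fintype σ] (w : σ → ℤ) :
    Derivation ℂ (MvPolynomial σ ℂ) (MvPolynomial σ ℂ) :=
  ∑ i, (w i : ℂ) • elem i i

theorem euler_weightedHomogeneousComponent [Fintype σ] (w : σ → ℤ) (s : ℤ)
    (p : MvPolynomial σ ℂ) :
    euler w (weightedHomogeneousComponent w s p) =
      (s : ℂ) • weightedHomogeneousComponent w s p := by
  induction p using MvPolynomial.induction_on' with
  | add p q hp hq => simp only [map_add, hp, hq, smul_add]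
  | monomial a c =>
    rw [weightedHomogeneousComponent_monomial]
    split_ifs with h
    · subst h
      have : ∀ i, elem i i (monomial a c) = (a i : ℂ) • monomial a c := fun i => by
        rw [elem_apply, X_mul_pderiv_monomial, Nat.cast_smul_eq_nsmul]
      rw [euler, derivation_sum_apply, Finsupp.weight_eq_sum, Int.cast_sum,
        Finset.sum_smul]
      refine Finset.sum_congr rfl fun i _ => ?_
      rw [Derivation.smul_apply, this, smul_smul]
      simp [mul_comm]
    · simp

theorem eq_C_of_pderiv_eq_zero {p : MvPolynomial σ ℂ} (h : ∀ i, pderiv i p = 0) :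
    p = C (coeff 0 p) := by
  classical
  ext a
  rw [coeff_C]
  split_ifs with ha
  · rw [ha]
  · obtain ⟨i, hi⟩ : ∃ i, a i ≠ 0 := by
      by_contra! hc
      exact ha (Finsupp.ext fun i => (hc i).symm)
    obtain ⟨b, rfl⟩ : ∃ b, a = b + Finsupp.single i 1 :=
      ⟨a - Finsupp.single i 1, (Finsupp.sub_add_single_one_cancel hi).symm⟩
    have := coeff_pderiv (i := i) p b
    rw [h i, coeff_zero] at this
    exact (mul_eq_zero.1 this.symm).resolve_right (by exact_mod_cast (b i).succ_ne_zero)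

end Operators
section Airy

variable {m : ℕ}

/-- The centred weight of the variable `v_i`. -/
def wt (i : Fin (m + 1)) : ℤ := 2 * (i : ℕ) - m

/-- The constant part `∑ v_{i+1}∂_i` of the connection matrix. -/
noncomputable def raise (m : ℕ) :
    Derivation ℂ (MvPolynomial (Fin (m + 1)) ℂ) (MvPolynomial (Fin (m + 1)) ℂ) :=
  ∑ i : Fin m, elem i.succ i.castSucc

/-- The coefficient `v_0 ∂_{n-1}` of `z` in the connection matrix. -/
noncomputable def wrap (m : ℕ) :
    Derivation ℂ (MvPolynomial (Fin (m + 1)) ℂ) (MvPolynomial (Fin (m + 1)) ℂ) :=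
  elem 0 (Fin.last m)

/-- The operator completing `raise` and `euler wt` to an `sl₂`-triple. -/
noncomputable def lower (m : ℕ) :
    Derivation ℂ (MvPolynomial (Fin (m + 1)) ℂ) (MvPolynomial (Fin (m + 1)) ℂ) :=
  ∑ i : Fin m, ((((i : ℕ) + 1) * (m - (i : ℕ)) : ℝ) : ℂ) • elem i.castSucc i.succ

/-- The inverse cyclic shift, which is adjoint to `raise + wrap`. -/
noncomputable def cyc (m : ℕ) :
    Derivation ℂ (MvPolynomial (Fin (m + 1)) ℂ) (MvPolynomial (Fin (m + 1)) ℂ) :=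
  ∑ i : Fin (m + 1), elem i (i + 1)

theorem raise_add_wrap : raise m + wrap m = ∑ i : Fin (m + 1), elem (i + 1) i := by
  rw [Fin.sum_univ_castSucc, Fin.last_add_one, raise, wrap]
  simp only [Fin.coeSucc_eq_succ]

theorem raise_add_wrap_X (j : Fin (m + 1)) :
    (raise m + wrap m) (X j) = (X (j + 1) : MvPolynomial (Fin (m + 1)) ℂ) := by
  rw [raise_add_wrap, derivation_sum_apply]
  simp [elem_X]

theorem cyc_X (j : Fin (m + 1)) : cyc m (X (j + 1)) = (X j : MvPolynomial (Fin (m + 1)) ℂ) := by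
  rw [cyc, derivation_sum_apply]
  simp [elem_X]

theorem raise_X_castSucc (j : Fin m) :
    raise m (X j.castSucc) = (X j.succ : MvPolynomial (Fin (m + 1)) ℂ) := by
  rw [raise, derivation_sum_apply]
  simp [elem_X]

theorem raise_X_last :
    raise m (X (Fin.last m)) = (0 : MvPolynomial (Fin (m + 1)) ℂ) := by
  rw [raise, derivation_sum_apply]
  exact Finset.sum_eq_zero fun i _ => by rw [elem_X, if_neg (Fin.castSucc_lt_last i).ne']

theorem lower_X_succ (j : Fin m) :
    lower m (X j.succ) =
      ((((j : ℕ) + 1) * (m - (j : ℕ)) : ℝ) : ℂ) • (X j.castSucc : MvPolynomial (Fin (m + 1)) ℂ) := by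
  rw [lower, derivation_sum_apply]
  simp [elem_X]

theorem lower_X_zero : lower m (X 0) = (0 : MvPolynomial (Fin (m + 1)) ℂ) := by
  rw [lower, derivation_sum_apply]
  exact Finset.sum_eq_zero fun i _ => by
    rw [Derivation.smul_apply, elem_X, if_neg (Fin.succ_ne_zero i).symm, smul_zero]

theorem euler_X (j : Fin (m + 1)) :
    euler wt (X j) = (wt j : ℂ) • (X j : MvPolynomial (Fin (m + 1)) ℂ) := by
  rw [euler, derivation_sum_apply]
  simp [elem_X]

theorem raise_lower_X (j : Fin (m + 1)) :
    raise m (lower m (X j)) =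
      (((j : ℕ) * (m + 1 - (j : ℕ)) : ℝ) : ℂ) • (X j : MvPolynomial (Fin (m + 1)) ℂ) := by
  cases j using Fin.cases with
  | zero => simp [lower_X_zero]
  | succ i =>
    rw [lower_X_succ, Derivation.map_smul, raise_X_castSucc]
    simp

theorem lower_raise_X (j : Fin (m + 1)) :
    lower m (raise m (X j)) =
      ((((j : ℕ) + 1) * (m - (j : ℕ)) : ℝ) : ℂ) • (X j : MvPolynomial (Fin (m + 1)) ℂ) := by
  cases j using Fin.lastCases with
  | last => simp [raise_X_last]
  | cast i =>
    rw [raise_X_castSucc, lower_X_succ]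
    simp

theorem lie_raise_lower : ⁅raise m, lower m⁆ = euler wt := by
  refine derivation_ext fun j => ?_
  rw [Derivation.commutator_apply, raise_lower_X, lower_raise_X, euler_X, ← sub_smul]
  congr 1
  simp only [wt]
  push_cast
  ring

theorem lie_wrap_lower : ⁅wrap m, lower m⁆ = 0 := by
  refine derivation_ext fun j => ?_
  rw [Derivation.commutator_apply, wrap, elem_X, Derivation.zero_apply]
  have : lower m (if j = Fin.last m then X 0 else 0) = 0 := by
    split_ifs
    · exact lower_X_zero
    · exact map_zero _
  rw [this, sub_zero]
  cases j using Fin.cases with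
  | zero => rw [lower_X_zero, map_zero]
  | succ i =>
    rw [lower_X_succ, Derivation.map_smul, elem_X, if_neg (Fin.castSucc_lt_last i).ne, smul_zero]

theorem lie_cyc : ⁅raise m + wrap m, cyc m⁆ = 0 := by
  refine derivation_ext fun j => ?_
  obtain ⟨i, rfl⟩ : ∃ i, j = i + 1 := ⟨j - 1, by simp⟩
  rw [Derivation.commutator_apply, raise_add_wrap_X, cyc_X, cyc_X, raise_add_wrap_X, sub_self,
    Derivation.zero_apply]

/-- `raise + wrap` is normal for the standard Fischer form, so its kernel meets its image in `0`. -/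
theorem raise_add_wrap_eq_zero {p : MvPolynomial (Fin (m + 1)) ℂ}
    (h : (raise m + wrap m) ((raise m + wrap m) p) = 0) : (raise m + wrap m) p = 0 := by
  set S := raise m + wrap m with hS
  have hadj : ∀ p q, fischer (fun _ => 1) q (S p) = fischer (fun _ => 1) (cyc m q) p := by
    intro p q
    rw [hS, raise_add_wrap, cyc, derivation_sum_apply, derivation_sum_apply, map_sum, fischer_sum]
    exact Finset.sum_congr rfl fun i _ => by
      simpa using fischer_elem (fun _ => 1) (i + 1) i p q
  have hadj' : ∀ p q, fischer (fun _ => 1) q (cyc m p) = fischer (fun _ => 1) (S q) p := by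
    intro p q
    rw [hS, raise_add_wrap, cyc, derivation_sum_apply, derivation_sum_apply, map_sum, fischer_sum]
    exact Finset.sum_congr rfl fun i _ => by
      simpa using fischer_elem (fun _ => 1) i (i + 1) p q
  have hcomm : S (cyc m (S p)) = cyc m (S (S p)) := by
    have := congrArg (fun D => D (S p)) (lie_cyc (m := m))
    rwa [Derivation.commutator_apply, Derivation.zero_apply, sub_eq_zero] at this
  have hc : cyc m (S p) = 0 := by
    apply eq_zero_of_fischer_self (ρ := fun _ => 1) fun _ => one_pos
    rw [hadj', hcomm, h, map_zero, fischer_zero, Complex.zero_re]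
  apply eq_zero_of_fischer_self (ρ := fun _ => 1) fun _ => one_pos
  rw [hadj, hc, fischer_zero, Complex.zero_re]

/-- Weights of the Fischer form for which `raise` and `lower` are adjoint. -/
noncomputable def airyWeight (i : Fin (m + 1)) : ℝ := (i : ℕ).factorial / (m - (i : ℕ)).factorial

theorem airyWeight_pos (i : Fin (m + 1)) : 0 < airyWeight i := by
  unfold airyWeight
  positivity

theorem airyWeight_succ (i : Fin m) :
    airyWeight i.succ = ((i : ℕ) + 1) * (m - (i : ℕ)) * airyWeight i.castSucc := by
  obtain ⟨d, hd⟩ : ∃ d, m = i + d + 1 := ⟨m - i - 1, by omega⟩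
  have h₁ : m - (i : ℕ) = d + 1 := by omega
  have h₂ : m - ((i : ℕ) + 1) = d := by omega
  have h₃ : (m : ℝ) - (i : ℕ) = d + 1 := by rw [← Nat.cast_sub i.2.le, h₁]; push_cast; rfl
  simp only [airyWeight, Fin.val_succ, Fin.val_castSucc, h₁, h₂, h₃, Nat.factorial_succ]
  push_cast
  field_simp

theorem fischer_raise (p q : MvPolynomial (Fin (m + 1)) ℂ) :
    fischer airyWeight q (raise m p) = fischer airyWeight (lower m q) p := by
  rw [raise, lower, derivation_sum_apply, derivation_sum_apply, map_sum]
  simp only [Derivation.smul_apply]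
  rw [fischer_sum_smul]
  refine Finset.sum_congr rfl fun i _ => ?_
  have h := fischer_elem airyWeight i.succ i.castSucc p q
  have h₀ : (airyWeight i.castSucc : ℂ) ≠ 0 := by exact_mod_cast (airyWeight_pos _).ne'
  rw [airyWeight_succ] at h
  refine mul_left_cancel₀ h₀ (h.trans ?_)
  push_cast
  ring

theorem pderiv_raise (i : Fin m) (p : MvPolynomial (Fin (m + 1)) ℂ) :
    pderiv i.succ (raise m p) = pderiv i.castSucc p + raise m (pderiv i.succ p) := by
  have h : ⁅pderiv (R := ℂ) i.succ, raise m⁆ = pderiv i.castSucc := by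
    refine derivation_ext fun j => ?_
    have h0 : raise m (pderiv i.succ (X j : MvPolynomial (Fin (m + 1)) ℂ)) = 0 := by
      rw [pderiv_X, Pi.single_apply]
      split_ifs
      · exact Derivation.map_one_eq_zero _
      · exact map_zero _
    rw [Derivation.commutator_apply, h0, sub_zero]
    cases j using Fin.lastCases with
    | last => rw [raise_X_last, map_zero, pderiv_X_of_ne (Fin.castSucc_lt_last i).ne']
    | cast l =>
      rw [raise_X_castSucc, pderiv_X, pderiv_X]
      simp [Pi.single_apply]
  rw [← h, Derivation.commutator_apply, sub_add_cancel]

/-- A polynomial killed by `raise` and `wrap` is constant. -/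
theorem eq_C_of_raise_wrap {p : MvPolynomial (Fin (m + 1)) ℂ} (hr : raise m p = 0)
    (hw : wrap m p = 0) : p = C (coeff 0 p) := by
  refine eq_C_of_pderiv_eq_zero fun i => ?_
  induction i using Fin.reverseInduction with
  | last => exact (mul_eq_zero.1 hw).resolve_left (X_ne_zero _)
  | cast i ih =>
    have h := pderiv_raise i p
    rwa [hr, ih, map_zero, map_zero, add_zero, eq_comm] at h


theorem weightedHomogeneousComponent_raise (s : ℤ) (p : MvPolynomial (Fin (m + 1)) ℂ) :
    weightedHomogeneousComponent wt s (raise m p) =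
      raise m (weightedHomogeneousComponent wt (s - 2) p) := by
  rw [raise, derivation_sum_apply, derivation_sum_apply, map_sum]
  refine Finset.sum_congr rfl fun i _ => ?_
  rw [weightedHomogeneousComponent_elem]
  congr 3
  simp only [wt, Fin.val_succ, Fin.val_castSucc]
  push_cast
  ring

theorem weightedHomogeneousComponent_wrap (s : ℤ) (p : MvPolynomial (Fin (m + 1)) ℂ) :
    weightedHomogeneousComponent wt s (wrap m p) =
      wrap m (weightedHomogeneousComponent wt (s + 2 * m) p) := by
  rw [wrap, weightedHomogeneousComponent_elem]
  congr 3
  simp only [wt, Fin.val_zero, Fin.val_last]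
  push_cast
  ring

theorem finsum_raise_add_wrap {A : ℤ → MvPolynomial (Fin (m + 1)) ℂ}
    (hA : (Function.support A).Finite) :
    ∑ᶠ j, (raise m (A j) + wrap m (A (j - 1))) = (raise m + wrap m) (∑ᶠ j, A j) := by
  have hr : (Function.support fun j => raise m (A j)).Finite :=
    hA.subset fun j hj h0 => hj (by simp [h0])
  have hw : (Function.support fun j => wrap m (A j)).Finite :=
    hA.subset fun j hj h0 => hj (by simp [h0])
  have hw' : (Function.support fun j => wrap m (A (j - 1))).Finite :=
    hw.preimage (Equiv.subRight (1 : ℤ)).injective.injOn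
  rw [finsum_add_distrib hr hw', Derivation.add_apply]
  congr 1
  · exact (derivation_map_finsum hA _).symm
  · exact (finsum_comp_equiv (Equiv.subRight (1 : ℤ)) (f := fun j => wrap m (A j))).trans
      (derivation_map_finsum hA _).symm

/-- The top weight of a horizontal section vanishes, by semisimplicity of `raise + wrap`. -/
theorem weight_eq_zero_or_finsum_eq_zero {w : ℤ} {G H : ℤ → MvPolynomial (Fin (m + 1)) ℂ}
    (hG : (Function.support G).Finite) (hH : (Function.support H).Finite)
    (h₀ : ∀ j, raise m (G j) + wrap m (G (j - 1)) = 0)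
    (h₁ : ∀ j : ℤ, ((j : ℂ) + 1) • G (j + 1) + (raise m (H j) + wrap m (H (j - 1))) = 0)
    (hw : ∀ j, euler wt (G j) = ((w - 2 * (m + 1) * j : ℤ) : ℂ) • G j) :
    w = 0 ∨ ∑ᶠ j, G j = 0 := by
  set S := raise m + wrap m with hS
  set g := ∑ᶠ j, G j with hg
  have hSg : S g = 0 := by
    rw [← finsum_raise_add_wrap hG]
    simp [h₀]
  have hsupp : (Function.support fun j : ℤ => (j : ℂ) • G j).Finite :=
    hG.subset fun j hj h0 => hj (by simp [h0])
  have hSH : ∑ᶠ j : ℤ, (j : ℂ) • G j = - S (∑ᶠ j, H j) := by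
    rw [← finsum_raise_add_wrap hH, ← finsum_neg_distrib,
      ← finsum_comp_equiv (Equiv.addRight (1 : ℤ))]
    refine finsum_congr fun j => ?_
    rw [← eq_neg_of_add_eq_zero_left (h₁ j)]
    simp
  have heuler : euler wt g = (w : ℂ) • g + S ((2 * (m + 1) : ℂ) • ∑ᶠ j, H j) := by
    have h3 : ∀ j : ℤ, euler wt (G j) =
        (w : ℂ) • G j + (-(2 * (m + 1)) : ℂ) • (j : ℂ) • G j := fun j => by
      rw [hw, smul_smul, ← add_smul]
      congr 1
      push_cast
      ring
    rw [hg, derivation_map_finsum hG, finsum_congr h3, finsum_add_distrib (hG.subset fun j hj h0 => hj (by simp [h0]))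
      (hsupp.subset fun j hj h0 => hj (by simp only [h0, smul_zero])), ← smul_finsum' _ hG,
      ← smul_finsum' _ hsupp, hSH, Derivation.map_smul]
    simp
  have hbr : euler wt g = S (lower m g) := by
    have h2 := congrArg (fun D => D g) (lie_wrap_lower (m := m))
    rw [Derivation.commutator_apply, Derivation.zero_apply, sub_eq_zero] at h2
    rw [← lie_raise_lower, Derivation.commutator_apply, hS, Derivation.add_apply, h2,
      sub_eq_iff_eq_add, add_assoc, ← map_add, add_comm (wrap m g), ← Derivation.add_apply, ← hS,
      hSg, map_zero, add_zero]
  have him : S (lower m g - (2 * (m + 1) : ℂ) • ∑ᶠ j, H j) = (w : ℂ) • g := by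
    rw [map_sub, ← hbr, heuler, add_sub_cancel_right]
  have hzero := raise_add_wrap_eq_zero (m := m)
    (p := lower m g - (2 * (m + 1) : ℂ) • ∑ᶠ j, H j)
    (by rw [← hS, him, Derivation.map_smul, hSg, smul_zero])
  rw [← hS, him] at hzero
  exact_mod_cast smul_eq_zero.1 hzero

/-- A polynomial solution, given by its coefficients `F j` of `z ^ j`, of the Airy system on
polynomials without constant term is zero. -/
theorem horizontal_eq_zero {F : ℤ → MvPolynomial (Fin (m + 1)) ℂ}
    (hF : (Function.support F).Finite) (hneg : ∀ j < 0, F j = 0) (hconst : ∀ j, coeff 0 (F j) = 0)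
    (hrec : ∀ j : ℤ, ((j : ℂ) + 1) • F (j + 1) + (raise m (F j) + wrap m (F (j - 1))) = 0) :
    F = 0 := by
  classical
  by_contra hne
  set A : ℤ → ℤ → MvPolynomial (Fin (m + 1)) ℂ :=
    fun j s => weightedHomogeneousComponent wt s (F j) with hA
  have hArec : ∀ j s : ℤ, ((j : ℂ) + 1) • A (j + 1) s +
      (raise m (A j (s - 2)) + wrap m (A (j - 1) (s + 2 * m))) = 0 := fun j s => by
    simpa only [map_add, map_smul, map_zero, weightedHomogeneousComponent_raise,
      weightedHomogeneousComponent_wrap] using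
      congrArg (weightedHomogeneousComponent wt s) (hrec j)
  have hA0 : ∀ {j}, F j = 0 → ∀ s, A j s = 0 := fun h s => by simp [hA, h]
  set W : Set ℤ := {w | ∃ j, A j (w - 2 * (m + 1) * j) ≠ 0} with hW
  have hWfin : W.Finite := by
    refine (hF.biUnion fun j _ => (weightedHomogeneousComponent_finsupp (w := wt) (F j)).preimage
      (sub_left_injective (b := 2 * (m + 1) * j)).injOn).subset ?_
    rintro w ⟨j, hj⟩
    exact Set.mem_biUnion (x := j) (fun h => hj (hA0 h _)) hj
  have hWne : W.Nonempty := by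
    obtain ⟨j, hj⟩ := Function.ne_iff.1 hne
    obtain ⟨s, hs⟩ : ∃ s, A j s ≠ 0 := by
      by_contra! hc
      apply hj
      rw [← sum_weightedHomogeneousComponent (w := wt) (F j)]
      exact finsum_eq_zero_of_forall_eq_zero hc
    exact ⟨s + 2 * (m + 1) * j, j, by rwa [add_sub_cancel_right]⟩
  obtain ⟨w, ⟨j₁, hj₁⟩, hmax⟩ := Set.exists_max_image W id hWfin hWne
  have hbig : ∀ j s : ℤ, w < s + 2 * (m + 1) * j → A j s = 0 := fun j s h => by
    by_contra hc
    have := hmax (s + 2 * (m + 1) * j) ⟨j, by rwa [add_sub_cancel_right]⟩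
    simp only [id] at this
    omega
  set G : ℤ → MvPolynomial (Fin (m + 1)) ℂ := fun j => A j (w - 2 * (m + 1) * j) with hGdef
  set H : ℤ → MvPolynomial (Fin (m + 1)) ℂ :=
    fun j => A j (w - 2 * (m + 2) - 2 * (m + 1) * j) with hHdef
  have hG : (Function.support G).Finite := hF.subset fun j hj h0 => hj (hA0 h0 _)
  have hH : (Function.support H).Finite := hF.subset fun j hj h0 => hj (hA0 h0 _)
  have h₀ : ∀ j, raise m (G j) + wrap m (G (j - 1)) = 0 := fun j => by
    have h := hArec j (w - 2 * (m + 1) * j + 2)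
    rw [hbig (j + 1) _ (by linarith), smul_zero, zero_add] at h
    convert h using 4 <;> ring
  have h₁ : ∀ j : ℤ, ((j : ℂ) + 1) • G (j + 1) + (raise m (H j) + wrap m (H (j - 1))) = 0 :=
    fun j => by
    have h := hArec j (w - 2 * (m + 1) * (j + 1))
    convert h using 5 <;> ring
  have heul : ∀ j, euler wt (G j) = ((w - 2 * (m + 1) * j : ℤ) : ℂ) • G j := fun j =>
    euler_weightedHomogeneousComponent _ _ _
  have hw0 : w = 0 := by
    refine (weight_eq_zero_or_finsum_eq_zero hG hH h₀ h₁ heul).resolve_right fun hsum => hj₁ ?_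
    have h := congrArg (weightedHomogeneousComponent wt (w - 2 * (m + 1) * j₁)) hsum
    rw [map_zero] at h
    have h2 := (weightedHomogeneousComponent (R := ℂ) (wt (m := m))
      (w - 2 * (m + 1) * j₁)).toAddMonoidHom.map_finsum hG
    refine Eq.trans ?_ (h2.symm.trans h)
    rw [finsum_eq_single _ j₁]
    · exact ((weightedHomogeneousComponent_isWeightedHomogeneous _
        _).weightedHomogeneousComponent_same).symm
    · intro j hj
      refine (weightedHomogeneousComponent_isWeightedHomogeneous _
        _).weightedHomogeneousComponent_ne _ fun heq => hj ?_
      have : 2 * ((m : ℤ) + 1) * j = 2 * (m + 1) * j₁ := by linarith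
      exact mul_left_cancel₀ (by positivity) this
  obtain ⟨j₀, hj₀, hmin⟩ := Set.exists_min_image (Function.support G) id hG ⟨j₁, hj₁⟩
  simp only [id] at hmin
  have hj₀nonneg : 0 ≤ j₀ := by
    by_contra! hlt
    exact hj₀ (hA0 (hneg _ hlt) _)
  have hr : raise m (G j₀) = 0 := by
    have : G (j₀ - 1) = 0 := by
      by_contra hc
      have := hmin _ hc
      omega
    simpa [this] using h₀ j₀
  have hnorm : ((-2 * (m + 1) * j₀ : ℤ) : ℝ) * (fischer airyWeight (G j₀) (G j₀)).re =
      (fischer airyWeight (lower m (G j₀)) (lower m (G j₀))).re := by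
    have h2 : raise m (lower m (G j₀)) = ((-2 * (m + 1) * j₀ : ℤ) : ℂ) • G j₀ := by
      have h3 := heul j₀
      rw [← lie_raise_lower, Derivation.commutator_apply, hr, map_zero, sub_zero, hw0] at h3
      rw [h3]
      congr 2
      ring
    rw [← fischer_raise, h2, map_smul, smul_eq_mul, ← Complex.ofReal_intCast,
      Complex.re_ofReal_mul]
  have hpos : 0 < (fischer airyWeight (G j₀) (G j₀)).re :=
    (fischer_self_nonneg airyWeight_pos _).lt_of_ne' fun h =>
      hj₀ (eq_zero_of_fischer_self airyWeight_pos h)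
  have hlow := fischer_self_nonneg airyWeight_pos (lower m (G j₀))
  have hj₀zero : j₀ = 0 := by
    by_contra hc
    have h2 : (0 : ℝ) < j₀ := by exact_mod_cast lt_of_le_of_ne hj₀nonneg (Ne.symm hc)
    rw [← hnorm] at hlow
    push_cast at hlow
    have : 0 < 2 * ((m : ℝ) + 1) * j₀ * (fischer airyWeight (G j₀) (G j₀)).re := by positivity
    linarith
  subst hj₀zero
  have hl : lower m (G 0) = 0 := by
    apply eq_zero_of_fischer_self airyWeight_pos
    rw [← hnorm]
    simp
  have hwrap : wrap m (G 0) = 0 := by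
    have h2 : raise m (G 1) + wrap m (G 0) = 0 := h₀ 1
    have h3 : lower m (wrap m (G 0)) = 0 := by
      have h4 := congrArg (fun D => D (G 0)) (lie_wrap_lower (m := m))
      simpa [Derivation.commutator_apply, hl] using h4
    apply eq_zero_of_fischer_self airyWeight_pos
    have h5 : raise m (-G 1) = wrap m (G 0) := by
      rw [map_neg, neg_eq_of_add_eq_zero_right h2]
    have h6 : fischer airyWeight (wrap m (G 0)) (raise m (-G 1)) = 0 := by
      rw [fischer_raise, h3, fischer_zero]
    rw [← h5] at h6 ⊢
    rw [h6, Complex.zero_re]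
  apply hj₀
  rw [eq_C_of_raise_wrap hr hwrap, hGdef]
  simp [hA, coeff_weightedHomogeneousComponent, hconst]

variable {k : ℕ}

/-- The exponent of the monomial `u_a`. -/
noncomputable def expo (a : PIdx (m + 1) k) : Fin (m + 1) →₀ ℕ :=
  Finsupp.equivFunOnFinite.symm fun i => (a.1 i : ℕ)

@[simp]
theorem expo_apply (a : PIdx (m + 1) k) (i : Fin (m + 1)) : expo a i = (a.1 i : ℕ) := rfl

theorem expo_injective : Function.Injective (expo (m := m) (k := k)) := fun _ _ h =>
  Subtype.ext (_root_.funext fun i => Fin.ext (DFunLike.congr_fun h i))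

theorem exists_expo_eq {e : Fin (m + 1) →₀ ℕ} (he : ∑ i, e i = k) :
    ∃ b : PIdx (m + 1) k, expo b = e :=
  ⟨⟨fun i => ⟨e i, Nat.lt_succ_of_le
    (he ▸ Finset.single_le_sum (fun _ _ => Nat.zero_le _) (Finset.mem_univ i))⟩, he⟩,
    Finsupp.ext fun _ => rfl⟩

theorem sum_expo (a : PIdx (m + 1) k) : ∑ i, expo a i = k := a.2

theorem shift_eq_iff {a : PIdx (m + 1) k} {i : Fin (m + 1)} (ha : 1 ≤ (a.1 i : ℕ))
    (b : PIdx (m + 1) k) :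
    ((fun l : Fin (m + 1) =>
        (a.1 l : ℕ) + (if (l : ℕ) = ((i : ℕ) + 1) % (m + 1) then 1 else 0)
          - (if l = i then 1 else 0)) = fun l => (b.1 l : ℕ)) ↔
      expo b = expo a - Finsupp.single i 1 + Finsupp.single (i + 1) 1 := by
  rw [eq_comm, _root_.funext_iff, DFunLike.ext_iff]
  refine forall_congr' fun l => ?_
  have hl : (l : ℕ) = ((i : ℕ) + 1) % (m + 1) ↔ i + 1 = l := by
    rw [Fin.ext_iff, Fin.val_add, Fin.coe_ofNat_eq_mod, Nat.add_mod_mod, eq_comm]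
  simp only [hl, expo_apply, Finsupp.add_apply, Finsupp.tsub_apply, Finsupp.single_apply,
    eq_comm (a := i) (b := l)]
  by_cases h : l = i
  · subst h
    simp only [if_true]
    have : (a.1 l : ℕ) + (if l + 1 = l then 1 else 0) - 1 =
      (a.1 l : ℕ) - 1 + (if l + 1 = l then 1 else 0) := by omega
    rw [this]
  · simp [h]

theorem sum_shift_monomial (a : PIdx (m + 1) k) (i : Fin (m + 1)) (c : ℂ) :
    (∑ b : PIdx (m + 1) k, if 1 ≤ (a.1 i : ℕ) ∧
      (fun l : Fin (m + 1) =>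
        (a.1 l : ℕ) + (if (l : ℕ) = ((i : ℕ) + 1) % (m + 1) then 1 else 0)
          - (if l = i then 1 else 0)) = (fun l => (b.1 l : ℕ)) then
        monomial (expo b) ((a.1 i : ℕ) * c) else 0) =
      elem (i + 1) i (monomial (expo a) c) := by
  by_cases ha : 1 ≤ (a.1 i : ℕ)
  · simp only [ha, true_and, shift_eq_iff ha]
    obtain ⟨d, hd⟩ : ∃ d, expo a = d + Finsupp.single i 1 :=
      ⟨expo a - Finsupp.single i 1, (Finsupp.sub_add_single_one_cancel (Nat.one_le_iff_ne_zero.1 ha)).symm⟩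
    have hsum := sum_expo a
    rw [hd] at hsum
    obtain ⟨b₀, hb₀⟩ : ∃ b : PIdx (m + 1) k,
        expo b = expo a - Finsupp.single i 1 + Finsupp.single (i + 1) 1 := by
      refine exists_expo_eq ?_
      rw [hd, add_tsub_cancel_right, ← hsum]
      simp [Finset.sum_add_distrib, Finsupp.single_apply]
    rw [elem_monomial, ← hb₀, Finset.sum_eq_single b₀, if_pos rfl, expo_apply, mul_comm]
    · exact fun b _ hb => if_neg fun h => hb (expo_injective h)
    · simp
  · rw [elem_monomial_of_eq_zero (by rw [expo_apply]; omega)]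
    exact Finset.sum_eq_zero fun b _ => if_neg fun h => ha h.1

/-- The polynomial in `v_0, …, v_m` with coefficients `c a`. -/
noncomputable def toPoly (c : PIdx (m + 1) k → ℂ) : MvPolynomial (Fin (m + 1)) ℂ :=
  ∑ a, monomial (expo a) (c a)

theorem coeff_toPoly (c : PIdx (m + 1) k → ℂ) (a : PIdx (m + 1) k) :
    coeff (expo a) (toPoly c) = c a := by
  classical
  simp [toPoly, coeff_sum, coeff_monomial, expo_injective.eq_iff]

theorem coeff_zero_toPoly (hk : 1 ≤ k) (c : PIdx (m + 1) k → ℂ) : coeff 0 (toPoly c) = 0 := by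
  classical
  rw [toPoly, coeff_sum]
  refine Finset.sum_eq_zero fun a _ => ?_
  rw [coeff_monomial, if_neg]
  intro h
  have := sum_expo a
  simp [h] at this
  omega

theorem toPoly_zero : toPoly (fun _ : PIdx (m + 1) k => 0) = 0 := by
  simp [toPoly]

theorem toPoly_coeff_AiD (f : AiSym (m + 1) k) (t : ℕ) :
    toPoly (fun b => (AiD (m + 1) k f b).coeff t) =
      ((t : ℂ) + 1) • toPoly (fun a => (f a).coeff (t + 1)) +
        (raise m (toPoly fun a => (f a).coeff t) +
          wrap m (toPoly fun a => (Polynomial.X * f a).coeff t)) := by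
  have hcoeff : ∀ b, (AiD (m + 1) k f b).coeff t = (f b).coeff (t + 1) * (t + 1) +
      ∑ a : PIdx (m + 1) k, ∑ i : Fin (m + 1), if 1 ≤ (a.1 i : ℕ) ∧
      (fun l : Fin (m + 1) =>
        (a.1 l : ℕ) + (if (l : ℕ) = ((i : ℕ) + 1) % (m + 1) then 1 else 0)
          - (if l = i then 1 else 0)) = (fun l => (b.1 l : ℕ)) then
        ((a.1 i : ℕ) : ℂ) * ((if (i : ℕ) = m then Polynomial.X else 1) * f a).coeff t else 0 := by
    intro b
    rw [← Polynomial.coeff_derivative]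
    simp only [AiD, LinearMap.pi_apply, LinearMap.add_apply, LinearMap.comp_apply,
      LinearMap.proj_apply, LinearMap.sum_apply, Polynomial.coeff_add, Polynomial.finsetSum_coeff,
      Nat.add_sub_cancel]
    congr 1
    refine Finset.sum_congr rfl fun a _ => Finset.sum_congr rfl fun i _ => ?_
    split_ifs <;> simp [Polynomial.coeff_natCast_mul]
  have hmon : ∀ (P : Prop) [Decidable P] (e : Fin (m + 1) →₀ ℕ) (c : ℂ),
      monomial e (if P then c else 0) = if P then monomial e c else 0 := fun P _ e c => by
    split_ifs <;> simp
  simp only [toPoly, hcoeff, map_add, map_sum, hmon, Finset.sum_add_distrib]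
  congr 1
  · rw [Finset.smul_sum]
    exact Finset.sum_congr rfl fun a _ => by rw [smul_monomial, smul_eq_mul, mul_comm]
  · rw [Finset.sum_comm, raise, wrap, ← Finset.sum_add_distrib]
    refine Finset.sum_congr rfl fun a _ => ?_
    rw [Finset.sum_comm]
    simp only [sum_shift_monomial]
    rw [Fin.sum_univ_castSucc, Fin.last_add_one, derivation_sum_apply]
    refine congrArg₂ (· + ·) ?_ ?_
    · refine Finset.sum_congr rfl fun i _ => ?_
      rw [Fin.coeSucc_eq_succ, if_neg (by simpa using i.2.ne), one_mul]
    · simp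

theorem AiD_eq_zero (hk : 1 ≤ k) {f : AiSym (m + 1) k} (hf : AiD (m + 1) k f = 0) : f = 0 := by
  set F : ℤ → MvPolynomial (Fin (m + 1)) ℂ :=
    fun j => toPoly fun a => if 0 ≤ j then (f a).coeff j.toNat else 0 with hFdef
  have hnat : ∀ t : ℕ, F t = toPoly fun a => (f a).coeff t := fun t => by simp [hFdef]
  have hneg : ∀ j < 0, F j = 0 := fun j hj => by simp [hFdef, hj.not_ge, toPoly_zero]
  have hfin : (Function.support F).Finite := by
    refine (Set.finite_Icc (0 : ℤ) (Finset.univ.sup fun a => (f a).natDegree : ℕ)).subset ?_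
    intro j hj
    have hj₀ : 0 ≤ j := not_lt.1 fun h => hj (hneg j h)
    lift j to ℕ using hj₀
    refine ⟨by positivity, ?_⟩
    by_contra! hlt
    apply hj
    rw [hnat, ← toPoly_zero]
    congr 1
    funext a
    exact Polynomial.coeff_eq_zero_of_natDegree_lt <|
      (Finset.le_sup (f := fun a => (f a).natDegree) (Finset.mem_univ a)).trans_lt
        (by exact_mod_cast hlt)
  have hrec : ∀ j : ℤ, ((j : ℂ) + 1) • F (j + 1) + (raise m (F j) + wrap m (F (j - 1))) = 0 := by
    intro j
    rcases lt_trichotomy j (-1) with hj | rfl | hj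
    · simp [hneg (j + 1) (by omega), hneg j (by omega), hneg (j - 1) (by omega)]
    · simp [hneg (-1) (by omega), hneg (-2) (by omega)]
    · lift j to ℕ using by omega
      have h := toPoly_coeff_AiD f j
      simp only [hf, Pi.zero_apply, Polynomial.coeff_zero, toPoly_zero] at h
      have hpred : F ((j : ℤ) - 1) = toPoly fun a => (Polynomial.X * f a).coeff j := by
        cases j with
        | zero => simp [hneg (-1) (by omega), toPoly_zero]
        | succ t =>
          have : ((t + 1 : ℕ) : ℤ) - 1 = t := by simp
          rw [this, hnat]
          simp [Polynomial.coeff_X_mul]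
      have hsucc : F ((j : ℤ) + 1) = toPoly fun a => (f a).coeff (j + 1) := by
        exact_mod_cast hnat (j + 1)
      rw [hpred, hsucc, hnat, h]
      simp
  have hF := horizontal_eq_zero hfin hneg (fun j => coeff_zero_toPoly hk _) hrec
  funext a
  refine Polynomial.ext fun t => ?_
  rw [← coeff_toPoly (fun a => (f a).coeff t) a, ← hnat, hF]
  simp

end Airy

end MvPolynomial.GeneralizedAiry

/-- The operator `D : Sym^k Ai_n → Sym^k Ai_n` is injective; equivalently
`H⁰_dR(𝔸¹, Sym^k Ai_n) = ker D` vanishes. -/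
theorem stmt_1 (n k : ℕ) (hn : 2 ≤ n) (hk : 1 ≤ k) :
    Function.Injective (AiD n k) ∧ LinearMap.ker (AiD n k) = ⊥ := by
  obtain ⟨m, rfl⟩ : ∃ m, n = m + 1 := ⟨n - 1, by omega⟩
  have h : LinearMap.ker (AiD (m + 1) k) = ⊥ :=
    LinearMap.ker_eq_bot'.2 fun _ => MvPolynomial.GeneralizedAiry.AiD_eq_zero hk
  exact ⟨LinearMap.ker_eq_bot.1 h, h⟩
end
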